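/- arXiv:1204.4085 — 3 statements merged into one kernel-verified Lean document; each statement's English description precedes it below -/
import Mathlib

section
/- For any integer l ≥ 4, Σ_{l1≥2, l2,l3≥1, l1+l2+l3=l} (3^{l1-1} - 1)·2^{l2} · ζ(l1,l2,l3) = ((l-1)(l+4)/6)·ζ(l). -/
/-- Riemann zeta value -/
noncomputable def rz (l : ℕ) : ℝ :=
  ∑' m : ℕ, if 0 < m then 1 / (m : ℝ) ^ l else 0

/-- double zeta value -/
noncomputable def dz (a b : ℕ) : ℝ :=
  ∑' p : ℕ × ℕ, if p.2 < p.1 ∧ 0 < p.2 then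
    1 / ((p.1 : ℝ) ^ a * (p.2 : ℝ) ^ b) else 0

/-- triple zeta value -/
noncomputable def tz (a b c : ℕ) : ℝ :=
  ∑' t : ℕ × ℕ × ℕ, if t.2.1 < t.1 ∧ t.2.2 < t.2.1 ∧ 0 < t.2.2 then
    1 / ((t.1 : ℝ) ^ a * (t.2.1 : ℝ) ^ b * (t.2.2 : ℝ) ^ c) else 0

/-- admissible triple indices of weight l -/
def TIdx (l : ℕ) : Finset (ℕ × ℕ × ℕ) :=
  (Finset.range (l + 1) ×ˢ Finset.range (l + 1) ×ˢ Finset.range (l + 1)).filter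
    (fun t => 2 ≤ t.1 ∧ 1 ≤ t.2.1 ∧ 1 ≤ t.2.2 ∧ t.1 + t.2.1 + t.2.2 = l)

namespace TripleZeta

open Finset Filter Topology
open scoped ENNReal

/-- The sequence `1 / (n - t)`, set to `0` at `n = 0`. -/
noncomputable def shiftInv (t : ℝ) (n : ℕ) : ℝ := if n = 0 then 0 else 1 / (n - t)

/-- The sum of the first `n` terms of `x`. -/
noncomputable def psum (x : ℕ → ℝ) (n : ℕ) : ℝ := ∑ i ∈ range n, x i

/-- The Cauchy product of two sequences. -/
noncomputable def conv (x y : ℕ → ℝ) (n : ℕ) : ℝ := ∑ p ∈ antidiagonal n, x p.1 * y p.2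

/-- The indicator of the positive integers. -/
noncomputable def posInd (n : ℕ) : ℝ := if n = 0 then 0 else 1

/-- The sum of `x m * y j` over the part `m + j > N` of the square `m, j ≤ N`. -/
noncomputable def boxErr (x y : ℕ → ℝ) (N : ℕ) : ℝ :=
  ∑ m ∈ range (N + 1), x m * (psum y (N + 1) - psum y (N + 1 - m))

lemma psum_succ (x : ℕ → ℝ) (n : ℕ) : psum x (n + 1) = psum x n + x n :=
  sum_range_succ _ _

lemma psum_zero (x : ℕ → ℝ) : psum x 0 = 0 := rfl

lemma conv_comm (x y : ℕ → ℝ) : conv x y = conv y x := by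
  funext n
  unfold conv
  rw [← Finset.Nat.sum_antidiagonal_swap]
  exact sum_congr rfl fun p _ => mul_comm _ _

lemma conv_assoc (x y z : ℕ → ℝ) : conv (conv x y) z = conv x (conv y z) := by
  funext n
  have h : ∀ (a b : ℕ → ℝ) n, conv a b n =
      PowerSeries.coeff n (PowerSeries.mk a * PowerSeries.mk b) := by
    intro a b n
    simp [conv, PowerSeries.coeff_mul]
  have h' : ∀ a b : ℕ → ℝ, PowerSeries.mk (conv a b) = PowerSeries.mk a * PowerSeries.mk b := by
    intro a b
    ext n
    rw [← h, PowerSeries.coeff_mk]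
  rw [h, h, h', h', mul_assoc]

lemma conv_const_mul (c : ℝ) (x y : ℕ → ℝ) (n : ℕ) :
    conv (fun n => c * x n) y n = c * conv x y n := by
  simp only [conv, mul_sum, mul_assoc]

lemma conv_eq_sum_range (x y : ℕ → ℝ) (n : ℕ) :
    conv x y n = ∑ m ∈ range (n + 1), x m * y (n - m) :=
  Finset.Nat.sum_antidiagonal_eq_sum_range_succ (fun a b => x a * y b) n

lemma conv_posInd (x : ℕ → ℝ) (n : ℕ) : conv x posInd n = psum x n := by
  rw [conv_eq_sum_range, sum_range_succ, psum]
  simp only [Nat.sub_self, posInd, if_true, mul_zero, add_zero]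
  refine sum_congr rfl fun m hm => ?_
  have := mem_range.1 hm
  rw [if_neg (by omega), mul_one]

lemma euler_conv {x x' y y' : ℕ → ℝ} {α β : ℝ} (hx : ∀ n : ℕ, (n - α) * x n = x' n)
    (hy : ∀ n : ℕ, (n - β) * y n = y' n) (n : ℕ) :
    (n - (α + β)) * conv x y n = conv x' y n + conv x y' n := by
  unfold conv
  rw [mul_sum, ← sum_add_distrib]
  refine sum_congr rfl fun p hp => ?_
  have h : (p.1 : ℝ) + p.2 = n := by exact_mod_cast mem_antidiagonal.1 hp
  rw [← hx, ← hy, ← h]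
  ring

lemma sum_conv (x y : ℕ → ℝ) (N : ℕ) :
    psum (conv x y) (N + 1) = ∑ m ∈ range (N + 1), x m * psum y (N + 1 - m) := by
  simp only [psum, conv_eq_sum_range]
  rw [sum_range_diag_flip (N + 1) fun a b => x a * y b]
  simp only [mul_sum]

lemma boxErr_eq (x y : ℕ → ℝ) (N : ℕ) :
    boxErr x y N = psum x (N + 1) * psum y (N + 1) - psum (conv x y) (N + 1) := by
  rw [sum_conv, boxErr, psum.eq_def x, sum_mul, ← sum_sub_distrib]
  exact sum_congr rfl fun m _ => mul_sub _ _ _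

lemma boxErr_comm (x y : ℕ → ℝ) (N : ℕ) : boxErr x y N = boxErr y x N := by
  rw [boxErr_eq, boxErr_eq, conv_comm, mul_comm]

lemma shiftInv_zero (t : ℝ) : shiftInv t 0 = 0 := if_pos rfl

lemma shiftInv_pos_eq (t : ℝ) {n : ℕ} (hn : n ≠ 0) : shiftInv t n = 1 / (n - t) := if_neg hn

lemma sub_mul_shiftInv {t : ℝ} (ht : t < 1) (n : ℕ) : (n - t) * shiftInv t n = posInd n := by
  rcases eq_or_ne n 0 with rfl | hn
  · simp [shiftInv, posInd]
  · have : (1 : ℝ) ≤ n := by exact_mod_cast Nat.one_le_iff_ne_zero.2 hn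
    have h : (n : ℝ) - t ≠ 0 := by linarith
    simp only [shiftInv, posInd, if_neg hn]
    field_simp

lemma eq_shiftInv_mul {t : ℝ} (ht : t < 1) {x y : ℕ → ℝ} (h0 : x 0 = 0)
    (h : ∀ n : ℕ, (n - t) * x n = y n) (n : ℕ) : x n = shiftInv t n * y n := by
  rcases eq_or_ne n 0 with rfl | hn
  · simp [shiftInv, h0]
  · rw [← h, ← mul_assoc, mul_comm (shiftInv t n), sub_mul_shiftInv ht, posInd, if_neg hn, one_mul]

lemma conv_zero_left {x : ℕ → ℝ} (y : ℕ → ℝ) (h : x 0 = 0) : conv x y 0 = 0 := by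
  simp [conv, h]

lemma conv_shiftInv_self {t : ℝ} (ht : t ≤ 1 / 8) (n : ℕ) :
    conv (shiftInv t) (shiftInv t) n = shiftInv (2 * t) n * (2 * psum (shiftInv t) n) := by
  refine eq_shiftInv_mul (y := fun n => 2 * psum (shiftInv t) n) (by linarith)
    (conv_zero_left _ (shiftInv_zero t)) (fun n => ?_) n
  have h := euler_conv (sub_mul_shiftInv (t := t) (by linarith))
    (sub_mul_shiftInv (t := t) (by linarith)) n
  rw [conv_comm posInd, conv_posInd] at h
  rw [two_mul, h]
  ring

/-- The inner double sum of `1 / ((m - 2 * t) * (j - t))` over `n > m > j > 0`. -/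
noncomputable def innerSum (t : ℝ) (n : ℕ) : ℝ :=
  psum (fun m => shiftInv (2 * t) m * psum (shiftInv t) m) n

lemma psum_conv_shiftInv {t : ℝ} (ht : t ≤ 1 / 8) (n : ℕ) :
    psum (conv (shiftInv t) (shiftInv t)) n = 2 * innerSum t n := by
  unfold innerSum psum
  rw [mul_sum]
  refine sum_congr rfl fun m _ => ?_
  rw [conv_shiftInv_self ht, psum]
  ring

lemma conv_conv_shiftInv {t : ℝ} (ht : t ≤ 1 / 8) (n : ℕ) :
    conv (conv (shiftInv t) (shiftInv t)) (shiftInv t) n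
      = shiftInv (3 * t) n * (6 * innerSum t n) := by
  refine eq_shiftInv_mul (y := fun n => 6 * innerSum t n) (by linarith)
    (conv_zero_left _ (conv_zero_left _ (shiftInv_zero t))) (fun n => ?_) n
  have h1 : ∀ n : ℕ, (n - t) * shiftInv t n = posInd n := sub_mul_shiftInv (by linarith)
  have h2 := euler_conv h1 h1
  have h := euler_conv (y := shiftInv t) (x' := fun n => conv posInd (shiftInv t) n +
    conv (shiftInv t) posInd n) h2 h1 n
  have e1 : conv (fun n => conv posInd (shiftInv t) n + conv (shiftInv t) posInd n) (shiftInv t) n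
      = 2 * conv (conv (shiftInv t) (shiftInv t)) posInd n := by
    have : (fun n => conv posInd (shiftInv t) n + conv (shiftInv t) posInd n)
        = fun n => 2 * conv (shiftInv t) posInd n := by
      funext n; rw [conv_comm posInd, two_mul]
    have key : conv (conv (shiftInv t) (shiftInv t)) posInd
        = conv (conv (shiftInv t) posInd) (shiftInv t) := by
      rw [conv_assoc, conv_comm (shiftInv t) (conv (shiftInv t) posInd)]
    rw [this, key, conv_const_mul]
  rw [e1, conv_posInd, psum_conv_shiftInv ht] at h
  linarith

lemma two_mul_innerSum {t : ℝ} (ht : t ≤ 1 / 8) (n : ℕ) :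
    2 * innerSum t n = conv (psum (shiftInv t)) (shiftInv t) n := by
  rw [← psum_conv_shiftInv ht, ← conv_posInd, conv_assoc, conv_comm, ← funext (conv_posInd _)]

lemma shiftInv_sub_shiftInv {t : ℝ} (ht : t < 1) {a b : ℕ} (ha : a ≠ 0) (hb : b ≠ 0) :
    shiftInv t a - shiftInv t (a + b) = b * (shiftInv t a * shiftInv t (a + b)) := by
  have : (1 : ℝ) ≤ a := by exact_mod_cast Nat.one_le_iff_ne_zero.2 ha
  have h1 : (a : ℝ) - t ≠ 0 := by linarith
  have h2 : (a : ℝ) + b - t ≠ 0 := by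
    have : (0 : ℝ) ≤ b := b.cast_nonneg
    linarith
  rw [shiftInv_pos_eq t ha, shiftInv_pos_eq t (by omega : a + b ≠ 0)]
  push_cast
  field_simp
  ring

lemma sum_shiftInv_mul_innerSum {t : ℝ} (ht : t ≤ 1 / 8) (N : ℕ) :
    psum (fun k => shiftInv t k * (2 * innerSum t k)) (N + 1) =
      ∑ m ∈ range (N + 1), shiftInv 0 m * psum (shiftInv t) m *
        (psum (shiftInv t) (m + 1) + psum (shiftInv t) (N + 1 - m)
          - psum (shiftInv t) (N + 1)) := by
  induction N with
  | zero => simp [psum, shiftInv_zero]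
  | succ N ih =>
    rw [psum_succ, ih, sum_range_succ _ (N + 1)]
    have e : N + 1 + 1 - (N + 1) = 1 := by omega
    rw [e, psum_succ _ 0, psum_zero, shiftInv_zero]
    simp only [add_zero, sub_self, mul_zero]
    rw [two_mul_innerSum ht, conv_eq_sum_range, sum_range_succ _ (N + 1), Nat.sub_self,
      shiftInv_zero, mul_zero, add_zero, mul_sum, ← sum_add_distrib]
    refine sum_congr rfl fun m hm => ?_
    have hm' := mem_range.1 hm
    have e2 : N + 1 + 1 - m = (N + 1 - m) + 1 := by omega
    rw [e2, psum_succ _ (N + 1), psum_succ _ (N + 1 - m)]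
    rcases eq_or_ne m 0 with rfl | h0
    · simp [psum, shiftInv_zero]
    · have h := shiftInv_sub_shiftInv (t := t) (by linarith) (a := N + 1 - m) (b := m)
        (by omega) h0
      rw [Nat.sub_add_cancel (by omega)] at h
      have h3 := sub_mul_shiftInv (t := 0) one_pos m
      rw [posInd, if_neg h0, sub_zero] at h3
      linear_combination (-shiftInv 0 m * psum (shiftInv t) m) * h -
        psum (shiftInv t) m * shiftInv t (N + 1 - m) * shiftInv t (N + 1) * h3

lemma psum_pow_three (x : ℕ → ℝ) (n : ℕ) :
    psum x n ^ 3 = psum (fun k => x k ^ 3 + 3 * (psum x k * psum x (k + 1) * x k)) n := by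
  induction n with
  | zero => simp [psum]
  | succ n ih => rw [psum_succ _ n, psum_succ _ n, ← ih, psum_succ]; ring

/-- The weight for which `boxErr` measures the failure of the main identity truncated at `N`. -/
noncomputable def errWeight (t : ℝ) (N m : ℕ) : ℝ :=
  psum (shiftInv t) (N + 1) * shiftInv t m
    + 2 * (shiftInv (2 * t) m * psum (shiftInv t) m)
    - 3 * (shiftInv 0 m * psum (shiftInv t) m)

lemma truncated_identity {t : ℝ} (ht : t ≤ 1 / 8) (N : ℕ) :
    psum (fun k => 6 * ((shiftInv (3 * t) k - shiftInv t k) * innerSum t k)) (N + 1) =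
      psum (fun k => shiftInv t k ^ 3 + 3 * (psum (shiftInv t) k * psum (shiftInv t) (k + 1) *
        (shiftInv t k - shiftInv 0 k))) (N + 1) - boxErr (errWeight t N) (shiftInv t) N := by
  have h1 : psum (fun k => 6 * ((shiftInv (3 * t) k - shiftInv t k) * innerSum t k)) (N + 1)
      = psum (conv (conv (shiftInv t) (shiftInv t)) (shiftInv t)) (N + 1)
        - 3 * psum (fun k => shiftInv t k * (2 * innerSum t k)) (N + 1) := by
    unfold psum
    rw [mul_sum, ← sum_sub_distrib]
    refine sum_congr rfl fun k _ => ?_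
    rw [conv_conv_shiftInv ht]
    ring
  have h2 := boxErr_eq (conv (shiftInv t) (shiftInv t)) (shiftInv t) N
  have h3 := boxErr_eq (shiftInv t) (shiftInv t) N
  have h4 : boxErr (errWeight t N) (shiftInv t) N =
      psum (shiftInv t) (N + 1) * boxErr (shiftInv t) (shiftInv t) N +
      boxErr (conv (shiftInv t) (shiftInv t)) (shiftInv t) N -
      3 * ∑ m ∈ range (N + 1), shiftInv 0 m * psum (shiftInv t) m *
        (psum (shiftInv t) (N + 1) - psum (shiftInv t) (N + 1 - m)) := by
    unfold boxErr
    rw [mul_sum, mul_sum, ← sum_add_distrib, ← sum_sub_distrib]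
    refine sum_congr rfl fun k _ => ?_
    rw [conv_shiftInv_self ht, errWeight]
    ring
  have h5 : psum (fun k => shiftInv t k ^ 3 + 3 * (psum (shiftInv t) k * psum (shiftInv t) (k + 1) *
        (shiftInv t k - shiftInv 0 k))) (N + 1) = psum (shiftInv t) (N + 1) ^ 3 -
        3 * ∑ m ∈ range (N + 1), shiftInv 0 m * psum (shiftInv t) m *
          psum (shiftInv t) (m + 1) := by
    rw [psum_pow_three]
    conv_lhs => unfold psum
    conv_rhs => unfold psum
    rw [mul_sum, ← sum_sub_distrib]
    refine sum_congr rfl fun k _ => ?_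
    ring
  have h6 : ∑ m ∈ range (N + 1), shiftInv 0 m * psum (shiftInv t) m *
        (psum (shiftInv t) (m + 1) + psum (shiftInv t) (N + 1 - m)
          - psum (shiftInv t) (N + 1)) = (∑ m ∈ range (N + 1), shiftInv 0 m *
          psum (shiftInv t) m * psum (shiftInv t) (m + 1)) -
          ∑ m ∈ range (N + 1), shiftInv 0 m * psum (shiftInv t) m *
        (psum (shiftInv t) (N + 1) - psum (shiftInv t) (N + 1 - m)) := by
    rw [← sum_sub_distrib]
    refine sum_congr rfl fun k _ => ?_
    ring
  rw [h1, sum_shiftInv_mul_innerSum ht, h4, h5, h6]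
  linear_combination h2 + psum (shiftInv t) (N + 1) * h3

lemma boxErr_errWeight_zero (N : ℕ) :
    boxErr (errWeight 0 N) (shiftInv 0) N = psum (fun k => shiftInv 0 k ^ 3) (N + 1) := by
  have h := truncated_identity (t := 0) (by norm_num) N
  simp only [mul_zero, sub_self, zero_mul, add_zero] at h
  have : psum (fun _ => (0 : ℝ)) (N + 1) = 0 := by simp [psum]
  linarith

lemma psum_sub_psum (x : ℕ → ℝ) {a b : ℕ} (h : a ≤ b) :
    psum x b - psum x a = ∑ i ∈ Ico a b, x i :=
  (sum_Ico_eq_sub x h).symm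

lemma abs_boxErr_le {x y X Y : ℕ → ℝ} {N : ℕ} (hx : ∀ m ≤ N, |x m| ≤ X m)
    (hy : ∀ j, |y j| ≤ Y j) : |boxErr x y N| ≤ boxErr X Y N := by
  unfold boxErr
  refine (abs_sum_le_sum_abs _ _).trans (sum_le_sum fun m hm => ?_)
  rw [abs_mul, psum_sub_psum _ (Nat.sub_le _ _), psum_sub_psum _ (Nat.sub_le _ _)]
  have hx' := hx m (Nat.lt_succ_iff.1 (mem_range.1 hm))
  exact mul_le_mul hx' ((abs_sum_le_sum_abs _ _).trans (sum_le_sum fun j _ => hy j))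
    (abs_nonneg _) ((abs_nonneg _).trans hx')

lemma boxErr_const_mul (c : ℝ) (x y : ℕ → ℝ) (N : ℕ) :
    boxErr (fun m => c * x m) y N = c * boxErr x y N := by
  simp only [boxErr, mul_sum, mul_assoc]

lemma shiftInv_nonneg {t : ℝ} (ht : t < 1) (n : ℕ) : 0 ≤ shiftInv t n := by
  rcases eq_or_ne n 0 with rfl | hn
  · simp [shiftInv]
  · have : (1 : ℝ) ≤ n := by exact_mod_cast Nat.one_le_iff_ne_zero.2 hn
    rw [shiftInv_pos_eq t hn]
    exact one_div_nonneg.2 (by linarith)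

lemma shiftInv_sub_inv {t : ℝ} (ht : t < 1) (n : ℕ) :
    shiftInv t n - shiftInv 0 n = t * (shiftInv t n * shiftInv 0 n) := by
  rcases eq_or_ne n 0 with rfl | hn
  · simp [shiftInv]
  · have : (1 : ℝ) ≤ n := by exact_mod_cast Nat.one_le_iff_ne_zero.2 hn
    have h1 : (n : ℝ) - t ≠ 0 := by linarith
    have h2 : (n : ℝ) ≠ 0 := by linarith
    rw [shiftInv_pos_eq t hn, shiftInv_pos_eq 0 hn]
    field_simp
    ring

lemma shiftInv_mono {s t : ℝ} (hst : s ≤ t) (ht : t < 1) (n : ℕ) :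
    shiftInv s n ≤ shiftInv t n := by
  rcases eq_or_ne n 0 with rfl | hn
  · simp [shiftInv]
  · have : (1 : ℝ) ≤ n := by exact_mod_cast Nat.one_le_iff_ne_zero.2 hn
    rw [shiftInv_pos_eq t hn, shiftInv_pos_eq s hn]
    exact one_div_le_one_div_of_le (by linarith) (by linarith)

lemma shiftInv_le {t : ℝ} (ht : t ≤ 1 / 2) (n : ℕ) : shiftInv t n ≤ 2 * shiftInv 0 n := by
  rcases eq_or_ne n 0 with rfl | hn
  · simp [shiftInv]
  · have : (1 : ℝ) ≤ n := by exact_mod_cast Nat.one_le_iff_ne_zero.2 hn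
    rw [shiftInv_pos_eq t hn, shiftInv_pos_eq 0 hn, sub_zero, mul_one_div,
      div_le_div_iff₀ (by linarith) (by linarith)]
    linarith

lemma shiftInv_sub_inv_nonneg {t : ℝ} (h0 : 0 ≤ t) (ht : t < 1) (n : ℕ) :
    0 ≤ shiftInv t n - shiftInv 0 n :=
  sub_nonneg.2 (shiftInv_mono h0 ht n)

lemma shiftInv_sub_inv_le {t : ℝ} (ht : t ≤ 1 / 2) (n : ℕ) :
    shiftInv t n - shiftInv 0 n ≤ shiftInv 0 n ^ 2 := by
  rw [shiftInv_sub_inv (by linarith)]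
  have h1 := shiftInv_le ht n
  have h2 := shiftInv_nonneg one_pos n
  have h3 := shiftInv_nonneg (t := t) (by linarith) n
  calc t * (shiftInv t n * shiftInv 0 n) ≤ 1 / 2 * (2 * shiftInv 0 n * shiftInv 0 n) := by
        gcongr
    _ = _ := by ring

lemma psum_mono {x y : ℕ → ℝ} (h : ∀ n, x n ≤ y n) (n : ℕ) : psum x n ≤ psum y n :=
  sum_le_sum fun i _ => h i

lemma psum_nonneg {x : ℕ → ℝ} (h : ∀ n, 0 ≤ x n) (n : ℕ) : 0 ≤ psum x n :=
  sum_nonneg fun i _ => h i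

lemma psum_le_psum {x : ℕ → ℝ} (h : ∀ n, 0 ≤ x n) {a b : ℕ} (hab : a ≤ b) :
    psum x a ≤ psum x b := by
  have := psum_sub_psum x hab
  have h2 : 0 ≤ ∑ i ∈ Ico a b, x i := sum_nonneg fun i _ => h i
  linarith

lemma psum_const_mul (c : ℝ) (x : ℕ → ℝ) (n : ℕ) :
    psum (fun k => c * x k) n = c * psum x n := by
  simp only [psum, mul_sum]

lemma psum_sub (x y : ℕ → ℝ) (n : ℕ) :
    psum (fun k => x k - y k) n = psum x n - psum y n := by
  simp only [psum, sum_sub_distrib]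

lemma inv_mul_psum_sub_le {m N : ℕ} (hm : m ≤ N) :
    shiftInv 0 m * (psum (shiftInv 0) (N + 1) - psum (shiftInv 0) (N + 1 - m))
      ≤ (psum (shiftInv 0) (N + 1) + 1) / (N + 1) := by
  have hN : (0 : ℝ) < N + 1 := by positivity
  have hinv := shiftInv_nonneg one_pos
  rcases eq_or_ne m 0 with rfl | h0
  · rw [shiftInv_zero, zero_mul]
    have := psum_nonneg hinv (N + 1)
    positivity
  have hm0 : (0 : ℝ) < m := by exact_mod_cast Nat.pos_of_ne_zero h0
  rw [psum_sub_psum _ (Nat.sub_le _ _), mul_sum]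
  have key : ∀ j ∈ Ico (N + 1 - m) (N + 1),
      shiftInv 0 m * shiftInv 0 j ≤ (shiftInv 0 j + shiftInv 0 m) / (N + 1) := by
    intro j hj
    have hj' := mem_Ico.1 hj
    have hj0 : j ≠ 0 := by omega
    have hjp : (0 : ℝ) < j := by exact_mod_cast Nat.pos_of_ne_zero hj0
    have hs : (N : ℝ) + 1 ≤ m + j := by
      have : N + 1 ≤ m + j := by omega
      exact_mod_cast this
    rw [shiftInv_pos_eq 0 h0, shiftInv_pos_eq 0 hj0, sub_zero, sub_zero, le_div_iff₀ hN]
    calc 1 / (m : ℝ) * (1 / j) * (N + 1) ≤ 1 / (m : ℝ) * (1 / j) * (m + j) := by gcongr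
      _ = _ := by field_simp
  refine (sum_le_sum key).trans ?_
  rw [← sum_div]
  gcongr
  rw [sum_add_distrib, sum_const, Nat.card_Ico, nsmul_eq_mul]
  have e : N + 1 - (N + 1 - m) = m := by omega
  rw [e, shiftInv_pos_eq 0 h0, sub_zero, mul_one_div_cancel hm0.ne']
  gcongr
  rw [← psum_sub_psum _ (Nat.sub_le _ _)]
  have := psum_nonneg hinv (N + 1 - m)
  linarith

lemma boxErr_sq_inv_le (N : ℕ) :
    boxErr (fun m => shiftInv 0 m ^ 2) (shiftInv 0) N ≤
      psum (shiftInv 0) (N + 1) * ((psum (shiftInv 0) (N + 1) + 1) / (N + 1)) := by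
  unfold boxErr
  rw [psum.eq_def _ (N + 1), sum_mul]
  refine sum_le_sum fun m hm => ?_
  dsimp only
  rw [pow_two, mul_assoc]
  exact mul_le_mul_of_nonneg_left
    (inv_mul_psum_sub_le (Nat.lt_succ_iff.1 (mem_range.1 hm))) (shiftInv_nonneg one_pos m)

lemma psum_inv_eq_harmonic (N : ℕ) : psum (shiftInv 0) (N + 1) = harmonic N := by
  rw [psum, sum_range_succ', shiftInv_zero, add_zero, harmonic]
  push_cast
  refine sum_congr rfl fun i _ => ?_
  rw [shiftInv_pos_eq 0 (Nat.succ_ne_zero i), sub_zero, one_div]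
  push_cast
  rfl

lemma tendsto_harmonic_pow_div : Tendsto
    (fun N : ℕ => (psum (shiftInv 0) (N + 1) + 1) ^ 3 / (N + 1)) atTop (𝓝 0) := by
  have h1 : Tendsto (fun x : ℝ => (Real.log x) ^ 3 / x) atTop (𝓝 0) :=
    (Real.isLittleO_pow_log_id_atTop (n := 3)).tendsto_div_nhds_zero
  have h2 : Tendsto (fun N : ℕ => Real.exp 2 * ((Real.log (Real.exp 2 * (N + 1))) ^ 3 /
      (Real.exp 2 * (N + 1)))) atTop (𝓝 (Real.exp 2 * 0)) := by
    refine (h1.comp ?_).const_mul _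
    exact (tendsto_atTop_add_const_right _ _ tendsto_natCast_atTop_atTop).const_mul_atTop
      (Real.exp_pos 2)
  rw [mul_zero] at h2
  refine squeeze_zero (fun N => ?_) (fun N => ?_) h2
  · have := psum_nonneg (shiftInv_nonneg one_pos) (N + 1)
    positivity
  · have hN : (0 : ℝ) < N + 1 := by positivity
    have h3 := psum_nonneg (shiftInv_nonneg one_pos) (N + 1)
    have h4 : psum (shiftInv 0) (N + 1) + 1 ≤ Real.log (Real.exp 2 * (N + 1)) := by
      rw [Real.log_mul (Real.exp_pos 2).ne' hN.ne', Real.log_exp, psum_inv_eq_harmonic]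
      have := harmonic_le_one_add_log N
      rcases Nat.eq_zero_or_pos N with rfl | hp
      · simp
      · have h5 : Real.log N ≤ Real.log (N + 1) :=
          Real.log_le_log (by exact_mod_cast hp) (by linarith)
        linarith
    have h6 : Real.exp 2 * ((Real.log (Real.exp 2 * (N + 1))) ^ 3 / (Real.exp 2 * (N + 1)))
        = (Real.log (Real.exp 2 * (N + 1))) ^ 3 / (N + 1) := by
      have := (Real.exp_pos 2).ne'
      field_simp
    rw [h6]
    gcongr

lemma tendsto_of_abs_le_boxErr {e : ℕ → ℝ} (c : ℝ)
    (h : ∀ N, |e N| ≤ c * ((psum (shiftInv 0) (N + 1) + 1) *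
      boxErr (fun m => shiftInv 0 m ^ 2) (shiftInv 0) N)) (hc : 0 ≤ c) :
    Tendsto e atTop (𝓝 0) := by
  have h2 := tendsto_harmonic_pow_div.const_mul c
  rw [mul_zero] at h2
  refine squeeze_zero_norm (fun N => (h N).trans ?_) h2
  have h3 := psum_nonneg (shiftInv_nonneg one_pos) (N + 1)
  refine mul_le_mul_of_nonneg_left ?_ hc
  set H := psum (shiftInv 0) (N + 1)
  calc _ ≤ (H + 1) * (H * ((H + 1) / (N + 1))) := by
        gcongr
        exact boxErr_sq_inv_le N
    _ ≤ (H + 1) * ((H + 1) * ((H + 1) / (N + 1))) := by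
        gcongr
        linarith
    _ = _ := by ring

lemma sum_Ico_inv_sq_le {m : ℕ} (hm : m ≠ 0) (n : ℕ) :
    ∑ j ∈ Ico m n, shiftInv 0 j ^ 2 ≤ 2 * shiftInv 0 m := by
  obtain ⟨k, rfl⟩ := Nat.exists_eq_succ_of_ne_zero hm
  have h := sum_Ioo_inv_sq_le (α := ℝ) k n
  have e : Ico k.succ n = Ioo k n := by ext; simp
  rw [e, shiftInv_pos_eq 0 hm, sub_zero, mul_one_div]
  push_cast
  refine le_trans (le_of_eq (sum_congr rfl fun j hj => ?_)) h
  rw [shiftInv_pos_eq 0 (by have := mem_Ioo.1 hj; omega), sub_zero, one_div, inv_pow]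

lemma abs_errWeight_le {t : ℝ} (ht : t ≤ 1 / 8) {N m : ℕ} (hm : m ≤ N) :
    |errWeight t N m| ≤ 18 * (psum (shiftInv 0) (N + 1) + 1) * shiftInv 0 m := by
  have hf := shiftInv_nonneg (t := t) (by linarith)
  have hh := shiftInv_nonneg one_pos
  have a0 := hf m
  have a1 := shiftInv_le (t := t) (by linarith) m
  have b0 := shiftInv_nonneg (t := 2 * t) (by linarith) m
  have b1 := shiftInv_le (t := 2 * t) (by linarith) m
  have c0 := hh m
  have d0 := psum_nonneg hf m
  have d1 := psum_le_psum hf (show m ≤ N + 1 by omega)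
  have d2 := psum_mono (fun n => shiftInv_le (t := t) (by linarith) n) (N + 1)
  rw [psum_const_mul] at d2
  have d3 := psum_nonneg hh (N + 1)
  unfold errWeight
  set H := psum (shiftInv 0) (N + 1)
  set A := psum (shiftInv t) (N + 1)
  set A' := psum (shiftInv t) m
  have p1 : A * shiftInv t m ≤ (2 * H) * (2 * shiftInv 0 m) := by gcongr
  have p2 : shiftInv (2 * t) m * A' ≤ (2 * shiftInv 0 m) * (2 * H) := by
    gcongr
    linarith
  have p3 : shiftInv 0 m * A' ≤ shiftInv 0 m * (2 * H) := by
    gcongr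
    linarith
  have q1 : 0 ≤ A * shiftInv t m := mul_nonneg (by linarith) a0
  have q2 : 0 ≤ shiftInv (2 * t) m * A' := by positivity
  have q3 : 0 ≤ shiftInv 0 m * A' := by positivity
  have q4 : 0 ≤ H * shiftInv 0 m := by positivity
  rw [abs_le]
  constructor <;> nlinarith

lemma abs_errWeight_sub_le {t : ℝ} (h0 : 0 ≤ t) (ht : t ≤ 1 / 8) {N m : ℕ} (hm : m ≤ N) :
    |errWeight t N m - errWeight 0 N m|
      ≤ 6 * (psum (shiftInv 0) (N + 1) + 1) * shiftInv 0 m ^ 2 := by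
  rcases eq_or_ne m 0 with rfl | hm0
  · simp [errWeight, shiftInv_zero]
  have hf := shiftInv_nonneg (t := t) (by linarith)
  have hh := shiftInv_nonneg one_pos
  have hg := shiftInv_sub_inv_nonneg h0 (show t < 1 by linarith)
  have hg' := shiftInv_sub_inv_le (show t ≤ 1 / 2 by linarith)
  have d0 := psum_nonneg hf m
  have d1 := psum_le_psum hf (show m ≤ N + 1 by omega)
  have d2 := psum_mono (fun n => shiftInv_le (t := t) (by linarith) n) (N + 1)
  rw [psum_const_mul] at d2
  have d3 := psum_nonneg hh (N + 1)
  have c0 := hh m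
  have e0 := psum_le_psum hg (show m ≤ N + 1 by omega)
  have e1 : psum (fun n => shiftInv t n - shiftInv 0 n) (N + 1) -
      psum (fun n => shiftInv t n - shiftInv 0 n) m ≤ 2 * shiftInv 0 m := by
    rw [psum_sub_psum _ (by omega)]
    exact (sum_le_sum fun j _ => hg' j).trans (sum_Ico_inv_sq_le hm0 _)
  rw [psum_sub, psum_sub] at e0 e1
  have f0 := shiftInv_sub_inv_nonneg (t := 2 * t) (by linarith) (by linarith) m
  have f1 := shiftInv_sub_inv_le (t := 2 * t) (by linarith) m
  have g0 := hg m
  have g1 := hg' m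
  unfold errWeight
  rw [mul_zero]
  set H := psum (shiftInv 0) (N + 1)
  set A := psum (shiftInv t) (N + 1)
  set A' := psum (shiftInv t) m
  set H' := psum (shiftInv 0) m
  have e : A * shiftInv t m + 2 * (shiftInv (2 * t) m * A') - 3 * (shiftInv 0 m * A') -
      (H * shiftInv 0 m + 2 * (shiftInv 0 m * H') - 3 * (shiftInv 0 m * H')) =
      A * (shiftInv t m - shiftInv 0 m) + 2 * (A' * (shiftInv (2 * t) m - shiftInv 0 m)) +
        shiftInv 0 m * (A - H - (A' - H')) := by ring
  rw [e, abs_of_nonneg (by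
    have : 0 ≤ A := by linarith
    have : 0 ≤ A - H - (A' - H') := by linarith
    positivity)]
  have p1 : A * (shiftInv t m - shiftInv 0 m) ≤ 2 * H * shiftInv 0 m ^ 2 := by gcongr
  have p2 : A' * (shiftInv (2 * t) m - shiftInv 0 m) ≤ 2 * H * shiftInv 0 m ^ 2 := by
    gcongr
    linarith
  have p3 : shiftInv 0 m * (A - H - (A' - H')) ≤ shiftInv 0 m * (2 * shiftInv 0 m) := by
    gcongr
  nlinarith [sq_nonneg (shiftInv 0 m)]

lemma boxErr_sub_left (x x' y : ℕ → ℝ) (N : ℕ) :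
    boxErr (fun m => x m - x' m) y N = boxErr x y N - boxErr x' y N := by
  simp only [boxErr, ← sum_sub_distrib, sub_mul]

lemma tendsto_boxErr_errWeight_sub {t : ℝ} (h0 : 0 ≤ t) (ht : t ≤ 1 / 8) :
    Tendsto (fun N => boxErr (errWeight t N) (shiftInv t) N -
      boxErr (errWeight 0 N) (shiftInv 0) N) atTop (𝓝 0) := by
  refine tendsto_of_abs_le_boxErr 24 (fun N => ?_) (by norm_num)
  have hg := shiftInv_sub_inv_nonneg h0 (show t < 1 by linarith)
  have e : boxErr (errWeight t N) (shiftInv t) N - boxErr (errWeight 0 N) (shiftInv 0) N =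
      boxErr (errWeight t N) (fun j => shiftInv t j - shiftInv 0 j) N +
      boxErr (fun m => errWeight t N m - errWeight 0 N m) (shiftInv 0) N := by
    rw [boxErr_comm (errWeight t N) (fun j => shiftInv t j - shiftInv 0 j), boxErr_sub_left,
      boxErr_sub_left,
      boxErr_comm (shiftInv t), boxErr_comm (shiftInv 0)]
    ring
  have h1 := abs_boxErr_le (N := N) (x := errWeight t N)
    (X := fun m => 18 * (psum (shiftInv 0) (N + 1) + 1) * shiftInv 0 m)
    (y := fun j => shiftInv t j - shiftInv 0 j) (Y := fun j => shiftInv 0 j ^ 2)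
    (fun m hm => abs_errWeight_le ht hm)
    (fun j => by rw [abs_of_nonneg (hg j)]; exact shiftInv_sub_inv_le (by linarith) j)
  have h2 := abs_boxErr_le (N := N) (x := fun m => errWeight t N m - errWeight 0 N m)
    (X := fun m => 6 * (psum (shiftInv 0) (N + 1) + 1) * shiftInv 0 m ^ 2)
    (y := shiftInv 0) (Y := shiftInv 0)
    (fun m hm => abs_errWeight_sub_le h0 ht hm)
    (fun j => by rw [abs_of_nonneg (shiftInv_nonneg one_pos j)])
  rw [boxErr_const_mul] at h1 h2
  rw [boxErr_comm (shiftInv 0)] at h1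
  rw [e]
  refine (abs_add_le _ _).trans ((add_le_add h1 h2).trans (le_of_eq ?_))
  ring

lemma psum_mul_psum (x y : ℕ → ℝ) (n : ℕ) :
    psum x n * psum y n = psum (fun k => x k * psum y k + y k * psum x k + x k * y k) n := by
  induction n with
  | zero => simp [psum]
  | succ n ih => rw [psum_succ, psum_succ, psum_succ, ← ih]; ring

lemma boxErr_inv_sq {t : ℝ} (ht : t ≤ 1 / 8) (N : ℕ) :
    boxErr (shiftInv 0) (fun m => shiftInv t m ^ 2) N =
      psum (fun k => shiftInv 0 k * shiftInv t k ^ 2 -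
        t * (shiftInv t k * shiftInv 0 k * (psum (fun m => shiftInv t m ^ 2) k +
          shiftInv t k * psum (shiftInv t) k)) -
        shiftInv t k * shiftInv 0 k * psum (shiftInv t) k) (N + 1) := by
  have h0 : ∀ n : ℕ, (n - 0) * shiftInv 0 n = posInd n := sub_mul_shiftInv one_pos
  have h1 : ∀ n : ℕ, (n - t) * shiftInv t n = posInd n := sub_mul_shiftInv (by linarith)
  have h2 : ∀ n : ℕ, (n - t) * shiftInv t n ^ 2 = shiftInv t n := by
    intro n
    rw [pow_two, ← mul_assoc, h1, posInd]
    split_ifs with h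
    · rw [h, shiftInv_zero, mul_zero]
    · rw [one_mul]
  have e1 : ∀ n, conv (shiftInv 0) (shiftInv t) n =
      shiftInv t n * (psum (shiftInv t) n + psum (shiftInv 0) n) := by
    refine eq_shiftInv_mul (y := fun n => psum (shiftInv t) n + psum (shiftInv 0) n)
      (by linarith) (conv_zero_left _ (shiftInv_zero 0)) fun n => ?_
    have h := euler_conv h0 h1 n
    rwa [conv_comm posInd, conv_posInd, conv_posInd, zero_add] at h
  have e2 : ∀ n, conv (shiftInv 0) (fun m => shiftInv t m ^ 2) n =
      shiftInv t n * (psum (fun m => shiftInv t m ^ 2) n +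
        shiftInv t n * (psum (shiftInv t) n + psum (shiftInv 0) n)) := by
    refine eq_shiftInv_mul (y := fun n => psum (fun m => shiftInv t m ^ 2) n +
        shiftInv t n * (psum (shiftInv t) n + psum (shiftInv 0) n))
      (by linarith) (conv_zero_left _ (shiftInv_zero 0)) fun n => ?_
    have h := euler_conv h0 h2 n
    rwa [conv_comm posInd, conv_posInd, e1, zero_add] at h
  rw [boxErr_eq, psum_mul_psum, ← psum_sub]
  congr 1
  funext k
  rw [e2]
  have h3 := shiftInv_sub_inv (t := t) (by linarith) k
  linear_combination (-psum (fun m => shiftInv t m ^ 2) k -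
    shiftInv t k * psum (shiftInv t) k) * h3

lemma tendsto_boxErr_inv_sq {t : ℝ} (ht : t ≤ 1 / 8) :
    Tendsto (fun N => boxErr (shiftInv 0) (fun m => shiftInv t m ^ 2) N) atTop (𝓝 0) := by
  refine tendsto_of_abs_le_boxErr 4 (fun N => ?_) (by norm_num)
  have hh := shiftInv_nonneg one_pos
  have h := abs_boxErr_le (N := N) (y := shiftInv 0) (Y := shiftInv 0)
    (x := fun m => shiftInv t m ^ 2) (X := fun m => 4 * shiftInv 0 m ^ 2)
    (fun m _ => by
      rw [abs_of_nonneg (sq_nonneg _)]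
      have := pow_le_pow_left₀ (shiftInv_nonneg (t := t) (by linarith) m)
        (shiftInv_le (by linarith) m) 2
      linarith)
    (fun j => by rw [abs_of_nonneg (hh j)])
  rw [boxErr_const_mul] at h
  rw [boxErr_comm]
  refine h.trans ?_
  have h1 : 0 ≤ boxErr (fun m => shiftInv 0 m ^ 2) (shiftInv 0) N :=
    (abs_nonneg _).trans (abs_boxErr_le (fun m _ => (abs_of_nonneg (sq_nonneg _)).le)
      fun j => (abs_of_nonneg (hh j)).le)
  have h2 := psum_nonneg hh (N + 1)
  nlinarith

/-- The connector `Γ(m + 1 - t) Γ(n + 1 - t) / (Γ(1 - t) Γ(m + n + 1 - t))`. -/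
noncomputable def connector (t : ℝ) (m n : ℕ) : ℝ :=
  ∏ i ∈ range n, ((i + 1 - t) / (m + i + 1 - t))

lemma connector_zero_right (t : ℝ) (m : ℕ) : connector t m 0 = 1 := rfl

lemma connector_succ_right (t : ℝ) (m n : ℕ) :
    connector t m (n + 1) = connector t m n * ((n + 1 - t) / (m + n + 1 - t)) :=
  prod_range_succ _ _

lemma connector_zero_left {t : ℝ} (ht : t < 1) (n : ℕ) : connector t 0 n = 1 := by
  refine prod_eq_one fun i _ => ?_
  have : (0 : ℝ) ≤ i := i.cast_nonneg
  rw [Nat.cast_zero, zero_add, div_self (by linarith)]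

lemma connector_succ_left {t : ℝ} (ht : t < 1) (m n : ℕ) :
    connector t (m + 1) n = connector t m n * ((m + 1 - t) / (m + n + 1 - t)) := by
  have hm : (0 : ℝ) ≤ m := m.cast_nonneg
  induction n with
  | zero =>
    rw [connector_zero_right, connector_zero_right, Nat.cast_zero, add_zero,
      div_self (by linarith), one_mul]
  | succ n ih =>
    have hn : (0 : ℝ) ≤ n := n.cast_nonneg
    rw [connector_succ_right, ih, connector_succ_right]
    push_cast
    have h1 : (m : ℝ) + n + 1 - t ≠ 0 := by linarith
    have h2 : (m : ℝ) + 1 + n + 1 - t ≠ 0 := by linarith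
    have h3 : (m : ℝ) + (n + 1) + 1 - t ≠ 0 := by linarith
    field_simp
    ring

lemma connector_comm {t : ℝ} (ht : t < 1) (m n : ℕ) : connector t m n = connector t n m := by
  induction m with
  | zero => rw [connector_zero_left ht, connector_zero_right]
  | succ m ih => rw [connector_succ_left ht, connector_succ_right, ih,
    add_comm (m : ℝ) n]

lemma connector_nonneg {t : ℝ} (ht : t < 1) (m n : ℕ) : 0 ≤ connector t m n := by
  refine prod_nonneg fun i _ => ?_
  have hm : (0 : ℝ) ≤ m := m.cast_nonneg
  have hi : (0 : ℝ) ≤ i := i.cast_nonneg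
  exact div_nonneg (by linarith) (by linarith)

lemma connector_antitone_right {t : ℝ} (ht : t < 1) (m n : ℕ) :
    connector t m (n + 1) ≤ connector t m n := by
  have hm : (0 : ℝ) ≤ m := m.cast_nonneg
  have hn : (0 : ℝ) ≤ n := n.cast_nonneg
  rw [connector_succ_right]
  refine mul_le_of_le_one_right (connector_nonneg ht m n) ?_
  rw [div_le_one (by linarith)]
  linarith

lemma tendsto_connector {t : ℝ} (ht : t < 1) {n : ℕ} (hn : n ≠ 0) :
    Tendsto (fun m => connector t m n) atTop (𝓝 0) := by
  have h1 : Tendsto (fun m : ℕ => (1 - t) / ((m : ℝ) + (1 - t))) atTop (𝓝 0) :=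
    Tendsto.div_atTop tendsto_const_nhds
      (tendsto_atTop_add_const_right _ _ tendsto_natCast_atTop_atTop)
  refine squeeze_zero (fun m => connector_nonneg ht m n) (fun m => ?_) h1
  obtain ⟨k, rfl⟩ := Nat.exists_eq_succ_of_ne_zero hn
  refine (antitone_nat_of_succ_le (connector_antitone_right ht m)
    (Nat.succ_le_succ (Nat.zero_le k))).trans (le_of_eq ?_)
  rw [connector_succ_right, connector_zero_right, one_mul, Nat.cast_zero]
  congr 1 <;> ring

lemma shiftInv_mul_connector {t : ℝ} (ht : t < 1) (m : ℕ) {n : ℕ} (hn : n ≠ 0) :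
    shiftInv t (m + 1) * connector t (m + 1) n =
      (connector t m n - connector t (m + 1) n) * shiftInv 0 n := by
  have hm : (0 : ℝ) ≤ m := m.cast_nonneg
  have hn' : (1 : ℝ) ≤ n := by exact_mod_cast Nat.one_le_iff_ne_zero.2 hn
  rw [connector_succ_left ht, shiftInv_pos_eq t (Nat.succ_ne_zero m), shiftInv_pos_eq 0 hn]
  push_cast
  have h1 : (m : ℝ) + n + 1 - t ≠ 0 := by linarith
  have h2 : (m : ℝ) + 1 - t ≠ 0 := by linarith
  have h3 : (n : ℝ) ≠ 0 := by linarith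
  field_simp
  ring

lemma hasSum_connector {t : ℝ} (ht : t < 1) (j : ℕ) {n : ℕ} (hn : n ≠ 0) :
    HasSum (fun k => if j < k then shiftInv t k * connector t k n else 0)
      (connector t j n * shiftInv 0 n) := by
  rw [hasSum_iff_tendsto_nat_of_nonneg (fun k => ?_), ← tendsto_add_atTop_iff_nat (j + 1)]
  · have h : ∀ i, ∑ k ∈ range (i + (j + 1)),
        (if j < k then shiftInv t k * connector t k n else 0) =
        (connector t j n - connector t (i + j) n) * shiftInv 0 n := by
      intro i
      induction i with
      | zero =>
        rw [zero_add, zero_add, sub_self, zero_mul]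
        refine sum_eq_zero fun k hk => if_neg ?_
        have := mem_range.1 hk
        omega
      | succ i ih =>
        have e : i + 1 + (j + 1) = i + (j + 1) + 1 := by omega
        rw [e, sum_range_succ, ih, if_pos (by omega)]
        have h := shiftInv_mul_connector ht (i + j) hn
        have e2 : i + (j + 1) = i + j + 1 := by omega
        have e3 : i + 1 + j = i + j + 1 := by omega
        rw [e2, e3, h]
        ring
    simp_rw [h]
    have h2 := ((tendsto_add_atTop_iff_nat j).2 (tendsto_connector ht hn)).const_sub
      (connector t j n)
    rw [sub_zero] at h2
    exact h2.mul_const _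
  · split_ifs
    · exact mul_nonneg (shiftInv_nonneg ht k) (connector_nonneg ht k n)
    · exact le_rfl

lemma tsum_ofReal_connector {t : ℝ} (ht : t < 1) (j : ℕ) {n : ℕ} (hn : n ≠ 0) :
    ∑' k, ENNReal.ofReal (if j < k then shiftInv t k * connector t k n else 0) =
      ENNReal.ofReal (shiftInv 0 n) * ENNReal.ofReal (connector t j n) := by
  have h := hasSum_connector ht j hn
  rw [← ENNReal.ofReal_tsum_of_nonneg (fun k => ?_) h.summable, h.tsum_eq, mul_comm,
    ENNReal.ofReal_mul (shiftInv_nonneg one_pos n)]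
  split_ifs
  · exact mul_nonneg (shiftInv_nonneg ht k) (connector_nonneg ht k n)
  · exact le_rfl

lemma tsum_connector_mul_psum {t : ℝ} (ht : t < 1) {w : ℕ → ℝ} (hw : ∀ j, 0 ≤ w j) {n : ℕ}
    (hn : n ≠ 0) :
    ∑' k, ENNReal.ofReal (shiftInv t k * connector t k n * psum w k) =
      ENNReal.ofReal (shiftInv 0 n) * ∑' j, ENNReal.ofReal (connector t j n * w j) := by
  have h1 : ∀ k, ENNReal.ofReal (shiftInv t k * connector t k n * psum w k) =
      ∑' j, ENNReal.ofReal (if j < k then shiftInv t k * connector t k n else 0) *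
        ENNReal.ofReal (w j) := by
    intro k
    rw [tsum_eq_sum (s := range k), psum, mul_sum, ENNReal.ofReal_sum_of_nonneg]
    · refine sum_congr rfl fun j hj => ?_
      rw [if_pos (mem_range.1 hj), ENNReal.ofReal_mul
        (mul_nonneg (shiftInv_nonneg ht k) (connector_nonneg ht k n))]
    · exact fun j _ => mul_nonneg
        (mul_nonneg (shiftInv_nonneg ht k) (connector_nonneg ht k n)) (hw j)
    · intro j hj
      rw [if_neg (by simpa using hj), ENNReal.ofReal_zero, zero_mul]
  simp_rw [h1]
  rw [ENNReal.tsum_comm, ← ENNReal.tsum_mul_left]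
  refine tsum_congr fun j => ?_
  rw [ENNReal.tsum_mul_right, tsum_ofReal_connector ht j hn,
    ENNReal.ofReal_mul (connector_nonneg ht j n), mul_assoc]

lemma tsum_shiftInv_mul_inv {t : ℝ} (ht : t < 1) {w : ℕ → ℝ} (hw : ∀ j, 0 ≤ w j) :
    ∑' k, ENNReal.ofReal (shiftInv t k * shiftInv 0 k * psum w k) =
      ∑' n, ENNReal.ofReal (shiftInv t n * shiftInv 0 n) *
        ∑' j, ENNReal.ofReal (connector t j n * w j) := by
  have h1 : ∀ k, ENNReal.ofReal (shiftInv t k * shiftInv 0 k * psum w k) =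
      ∑' n, ENNReal.ofReal (shiftInv t n) *
        ENNReal.ofReal (shiftInv t k * connector t k n * psum w k) := by
    intro k
    rcases eq_or_ne k 0 with rfl | hk
    · simp [shiftInv_zero]
    have h2 := tsum_ofReal_connector ht 0 hk
    rw [connector_zero_left ht, ENNReal.ofReal_one, mul_one] at h2
    have h3 : ∀ n, ENNReal.ofReal (shiftInv t n) *
        ENNReal.ofReal (shiftInv t k * connector t k n * psum w k) =
        ENNReal.ofReal (if 0 < n then shiftInv t n * connector t n k else 0) *
        ENNReal.ofReal (shiftInv t k * psum w k) := by
      intro n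
      split_ifs with hn
      · rw [← ENNReal.ofReal_mul (shiftInv_nonneg ht n), ← ENNReal.ofReal_mul
          (mul_nonneg (shiftInv_nonneg ht n) (connector_nonneg ht n k)), connector_comm ht]
        congr 1
        ring
      · have : n = 0 := by omega
        rw [this, shiftInv_zero, ENNReal.ofReal_zero, zero_mul, zero_mul]
    simp_rw [h3]
    rw [ENNReal.tsum_mul_right, h2, ← ENNReal.ofReal_mul (shiftInv_nonneg one_pos k)]
    congr 1
    ring
  simp_rw [h1]
  rw [ENNReal.tsum_comm]
  refine tsum_congr fun n => ?_
  rcases eq_or_ne n 0 with rfl | hn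
  · simp [shiftInv_zero]
  · rw [ENNReal.tsum_mul_left, tsum_connector_mul_psum ht hw hn, ← mul_assoc,
      ENNReal.ofReal_mul (shiftInv_nonneg ht n)]

lemma tsum_connector_mul_shiftInv {t : ℝ} (ht : t < 1) {n : ℕ} (hn : n ≠ 0) :
    ∑' j, ENNReal.ofReal (connector t j n * shiftInv t j) = ENNReal.ofReal (shiftInv 0 n) := by
  have h := tsum_ofReal_connector ht 0 hn
  rw [connector_zero_left ht, ENNReal.ofReal_one, mul_one] at h
  rw [← h]
  refine tsum_congr fun j => ?_
  split_ifs with hj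
  · rw [mul_comm]
  · have : j = 0 := by omega
    rw [this, shiftInv_zero, mul_zero]

lemma hasSum_of_tsum_ofReal_eq {x y : ℕ → ℝ} (hx : ∀ n, 0 ≤ x n) (hy : ∀ n, 0 ≤ y n)
    (hs : Summable y) (h : ∑' n, ENNReal.ofReal (x n) = ∑' n, ENNReal.ofReal (y n)) :
    HasSum x (∑' n, y n) := by
  have hx' : Summable x := by
    have h1 : ∑' n, ENNReal.ofReal (x n) ≠ ∞ := by
      rw [h, ← ENNReal.ofReal_tsum_of_nonneg hy hs]
      exact ENNReal.ofReal_ne_top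
    refine (ENNReal.summable_toReal h1).congr fun n => ?_
    rw [ENNReal.toReal_ofReal (hx n)]
  rw [← ENNReal.ofReal_tsum_of_nonneg hy hs, ← ENNReal.ofReal_tsum_of_nonneg hx hx',
    ENNReal.ofReal_eq_ofReal_iff (tsum_nonneg hx) (tsum_nonneg hy)] at h
  rw [← h]
  exact hx'.hasSum

lemma summable_inv_pow {r : ℕ} (hr : 2 ≤ r) : Summable fun n => shiftInv 0 n ^ r := by
  refine (Real.summable_one_div_nat_pow.2 (show 1 < r by omega)).congr fun n => ?_
  rcases eq_or_ne n 0 with rfl | hn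
  · rw [shiftInv_zero, Nat.cast_zero, zero_pow (show r ≠ 0 by omega), div_zero]
  · rw [shiftInv_pos_eq 0 hn, sub_zero, one_div_pow]

lemma summable_of_le_inv_pow {x : ℕ → ℝ} {c : ℝ} {r : ℕ} (hr : 2 ≤ r) (hx : ∀ n, 0 ≤ x n)
    (h : ∀ n, x n ≤ c * shiftInv 0 n ^ r) : Summable x :=
  .of_nonneg_of_le hx h ((summable_inv_pow hr).mul_left c)

lemma summable_shiftInv_mul_inv_pow {t : ℝ} (ht : t ≤ 1 / 2) {r : ℕ} (hr : 1 ≤ r) :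
    Summable fun n => shiftInv t n * shiftInv 0 n ^ r := by
  have hh := shiftInv_nonneg one_pos
  refine summable_of_le_inv_pow (c := 2) (r := r + 1) (by omega)
    (fun n => mul_nonneg (shiftInv_nonneg (by linarith) n) (pow_nonneg (hh n) r)) fun n => ?_
  rw [pow_succ', ← mul_assoc]
  exact mul_le_mul_of_nonneg_right (shiftInv_le ht n) (pow_nonneg (hh n) r)

/-- The generating function of the sum formula for double zeta values. -/
lemma hasSum_double {t : ℝ} (ht : t ≤ 1 / 2) :
    HasSum (fun k => shiftInv t k * shiftInv 0 k * psum (shiftInv t) k)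
      (∑' n, shiftInv t n * shiftInv 0 n ^ 2) := by
  have ht' : t < 1 := by linarith
  have hf := shiftInv_nonneg ht'
  have hh := shiftInv_nonneg one_pos
  refine hasSum_of_tsum_ofReal_eq
    (fun n => mul_nonneg (mul_nonneg (hf n) (hh n)) (psum_nonneg hf n))
    (fun n => mul_nonneg (hf n) (pow_nonneg (hh n) _))
    (summable_shiftInv_mul_inv_pow ht (by norm_num)) ?_
  rw [tsum_shiftInv_mul_inv ht' hf]
  refine tsum_congr fun n => ?_
  rcases eq_or_ne n 0 with rfl | hn
  · simp [shiftInv_zero]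
  rw [tsum_connector_mul_shiftInv ht' hn, ← ENNReal.ofReal_mul (mul_nonneg (hf n) (hh n))]
  congr 1
  ring

/-- The generating function of the sum formula for triple zeta values. -/
lemma hasSum_triple {t : ℝ} (ht : t ≤ 1 / 2) :
    HasSum (fun k => shiftInv t k * shiftInv 0 k *
      psum (fun j => shiftInv t j * psum (shiftInv t) j) k)
      (∑' n, shiftInv t n * shiftInv 0 n ^ 3) := by
  have ht' : t < 1 := by linarith
  have hf := shiftInv_nonneg ht'
  have hh := shiftInv_nonneg one_pos
  have hw : ∀ j, 0 ≤ shiftInv t j * psum (shiftInv t) j :=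
    fun j => mul_nonneg (hf j) (psum_nonneg hf j)
  refine hasSum_of_tsum_ofReal_eq
    (fun n => mul_nonneg (mul_nonneg (hf n) (hh n)) (psum_nonneg hw n))
    (fun n => mul_nonneg (hf n) (pow_nonneg (hh n) _))
    (summable_shiftInv_mul_inv_pow ht (by norm_num)) ?_
  rw [tsum_shiftInv_mul_inv ht' hw]
  refine tsum_congr fun n => ?_
  rcases eq_or_ne n 0 with rfl | hn
  · simp [shiftInv_zero]
  have h : ∀ j, connector t j n * (shiftInv t j * psum (shiftInv t) j) =
      shiftInv t j * connector t j n * psum (shiftInv t) j := fun j => by ring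
  simp_rw [h]
  rw [tsum_connector_mul_psum ht' hf hn, tsum_connector_mul_shiftInv ht' hn,
    ← ENNReal.ofReal_mul (hh n), ← ENNReal.ofReal_mul (mul_nonneg (hf n) (hh n))]
  congr 1
  ring

lemma tendsto_psum_of_hasSum {x : ℕ → ℝ} {a : ℝ} (h : HasSum x a) :
    Tendsto (fun N => psum x (N + 1)) atTop (𝓝 a) :=
  (tendsto_add_atTop_iff_nat 1).2 h.tendsto_sum_nat

/-- The summand of the single series equal to the generating function of the weighted sums. -/
noncomputable def singleTerm (t : ℝ) (n : ℕ) : ℝ :=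
  shiftInv t n ^ 3 - shiftInv 0 n ^ 3 + 6 * t * (shiftInv t n * shiftInv 0 n ^ 3) +
    3 * (shiftInv 0 n * shiftInv t n ^ 2) - 3 * (shiftInv t n * shiftInv 0 n ^ 2)

lemma innerSum_nonneg {t : ℝ} (ht : t ≤ 1 / 8) (n : ℕ) : 0 ≤ innerSum t n :=
  psum_nonneg (fun m => mul_nonneg (shiftInv_nonneg (by linarith) m)
    (psum_nonneg (shiftInv_nonneg (by linarith)) m)) n

lemma hasSum_innerSum {t : ℝ} (h0 : 0 ≤ t) (ht : t ≤ 1 / 8) :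
    ∃ a, HasSum (fun k => 6 * ((shiftInv (3 * t) k - shiftInv t k) * innerSum t k)) a ∧
      HasSum (singleTerm t) a := by
  have hf := shiftInv_nonneg (show t < 1 by linarith)
  have hh := shiftInv_nonneg one_pos
  have hle := shiftInv_le (show t ≤ 1 / 2 by linarith)
  have s1 : Summable fun n => shiftInv t n ^ 3 :=
    summable_of_le_inv_pow (c := 8) (r := 3) (by norm_num) (fun n => pow_nonneg (hf n) 3)
      fun n => (pow_le_pow_left₀ (hf n) (hle n) 3).trans (le_of_eq (by ring))
  have s2 : Summable fun n => shiftInv 0 n * shiftInv t n ^ 2 :=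
    summable_of_le_inv_pow (c := 4) (r := 3) (by norm_num)
      (fun n => mul_nonneg (hh n) (pow_nonneg (hf n) 2))
      fun n => (mul_le_mul_of_nonneg_left (pow_le_pow_left₀ (hf n) (hle n) 2) (hh n)).trans
        (le_of_eq (by ring))
  have s3 : Summable fun n => shiftInv 0 n ^ 3 := summable_inv_pow (by norm_num)
  have g3 := hasSum_triple (show t ≤ 1 / 2 by linarith)
  have g2 := hasSum_double (show t ≤ 1 / 2 by linarith)
  have c3 := summable_shiftInv_mul_inv_pow (show t ≤ 1 / 2 by linarith) (r := 3) (by norm_num)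
  have c2 := summable_shiftInv_mul_inv_pow (show t ≤ 1 / 2 by linarith) (r := 2) (by norm_num)
  have main := (((s1.hasSum.sub s3.hasSum).add (g3.mul_left (6 * t))).add
    (s2.hasSum.mul_left 3)).sub (g2.mul_left 3)
  refine ⟨_, ?_, (((s1.hasSum.sub s3.hasSum).add (c3.hasSum.mul_left (6 * t))).add
    (s2.hasSum.mul_left 3)).sub (c2.hasSum.mul_left 3)⟩
  rw [hasSum_iff_tendsto_nat_of_nonneg fun k => by
    have := innerSum_nonneg ht k
    have := shiftInv_mono (show t ≤ 3 * t by linarith) (by linarith) k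
    have : 0 ≤ shiftInv (3 * t) k - shiftInv t k := by linarith
    positivity]
  rw [← tendsto_add_atTop_iff_nat 1]
  have lim := ((tendsto_psum_of_hasSum main).sub ((tendsto_boxErr_inv_sq ht).const_mul 3)).sub
    (tendsto_boxErr_errWeight_sub h0 ht)
  rw [mul_zero, sub_zero, sub_zero] at lim
  refine lim.congr fun N => ?_
  rw [boxErr_errWeight_zero, boxErr_inv_sq ht, ← psum_const_mul, sub_sub_eq_add_sub, ← psum_sub]
  refine Eq.trans ?_ (truncated_identity ht N).symm
  congr 1
  unfold psum
  rw [← sum_add_distrib]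
  refine sum_congr rfl fun k _ => ?_
  have h1 := shiftInv_sub_inv (show t < 1 by linarith) k
  have h2 := psum_mul_psum (shiftInv t) (shiftInv t) k
  have h3 : psum (fun k => shiftInv t k * psum (shiftInv t) k + shiftInv t k *
      psum (shiftInv t) k + shiftInv t k * shiftInv t k) k =
      2 * psum (fun j => shiftInv t j * psum (shiftInv t) j) k +
      psum (fun m => shiftInv t m ^ 2) k := by
    simp only [psum, sum_add_distrib, ← pow_two]
    ring
  rw [h3] at h2
  change _ = shiftInv t k ^ 3 + 3 * (psum (shiftInv t) k * psum (shiftInv t) (k + 1) *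
    (shiftInv t k - shiftInv 0 k))
  rw [h1, psum_succ]
  change shiftInv t k ^ 3 - shiftInv 0 k ^ 3 + 6 * t * (shiftInv t k * shiftInv 0 k *
    psum (fun j => shiftInv t j * psum (shiftInv t) j) k) +
    3 * (shiftInv 0 k * shiftInv t k ^ 2) - 3 * (shiftInv t k * shiftInv 0 k *
    psum (shiftInv t) k) - 3 * (shiftInv 0 k * shiftInv t k ^ 2 - t * (shiftInv t k *
    shiftInv 0 k * (psum (fun m => shiftInv t m ^ 2) k + shiftInv t k * psum (shiftInv t) k)) -
    shiftInv t k * shiftInv 0 k * psum (shiftInv t) k) + shiftInv 0 k ^ 3 = _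
  linear_combination (-3 * t * shiftInv t k * shiftInv 0 k) * h2

lemma shiftInv_eq_inv_div (s : ℝ) (n : ℕ) :
    shiftInv s n = shiftInv 0 n / (1 - s * shiftInv 0 n) := by
  rcases eq_or_ne n 0 with rfl | hn
  · simp [shiftInv_zero]
  · have : (n : ℝ) ≠ 0 := by exact_mod_cast hn
    rw [shiftInv_pos_eq _ hn, shiftInv_pos_eq _ hn, sub_zero]
    field_simp

lemma inv_le_one (n : ℕ) : shiftInv 0 n ≤ 1 := by
  rcases eq_or_ne n 0 with rfl | hn
  · simp [shiftInv_zero]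
  · rw [shiftInv_pos_eq _ hn, sub_zero]
    exact div_le_one_of_le₀ (by exact_mod_cast Nat.one_le_iff_ne_zero.2 hn) (by positivity)

lemma abs_mul_inv_lt_one {s : ℝ} (h0 : 0 ≤ s) (hs : s < 1) (n : ℕ) :
    |s * shiftInv 0 n| < 1 := by
  have := shiftInv_nonneg one_pos n
  rw [abs_of_nonneg (by positivity)]
  nlinarith [inv_le_one n]

lemma hasSum_shiftInv {s : ℝ} (h0 : 0 ≤ s) (hs : s < 1) (n : ℕ) :
    HasSum (fun b => s ^ b * shiftInv 0 n ^ (b + 1)) (shiftInv s n) := by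
  have h := (hasSum_geometric_of_abs_lt_one (abs_mul_inv_lt_one h0 hs n)).mul_left (shiftInv 0 n)
  rw [shiftInv_eq_inv_div s, div_eq_mul_inv]
  refine h.congr_fun fun b => ?_
  ring

/-- The coefficients of the generating function of the right-hand sides. -/
noncomputable def singleCoeff (i : ℕ) : ℝ := if i = 0 then 0 else (i + 2) * (i + 7) / 2

lemma singleCoeff_nonneg (i : ℕ) : 0 ≤ singleCoeff i := by
  unfold singleCoeff
  positivity

lemma hasSum_singleTerm {t : ℝ} (h0 : 0 ≤ t) (ht : t < 1) (n : ℕ) :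
    HasSum (fun i => singleCoeff i * t ^ i * shiftInv 0 n ^ (i + 3)) (singleTerm t n) := by
  have hx := abs_mul_inv_lt_one h0 ht n
  have hx' : ‖t * shiftInv 0 n‖ < 1 := hx
  set h := shiftInv 0 n with hh
  have g0 := hasSum_geometric_of_abs_lt_one hx
  have g1 := hasSum_choose_mul_geometric_of_norm_lt_one 1 hx'
  have g2 := hasSum_choose_mul_geometric_of_norm_lt_one 2 hx'
  have e := hasSum_ite_eq 0 (1 : ℝ)
  have key := (((((g2.sub e).add ((g0.sub e).mul_left 6)).add (g1.mul_left 3)).sub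
    (g0.mul_left 3))).mul_left (h ^ 3)
  have hne : 1 - t * h ≠ 0 := by
    have := (abs_lt.1 hx).2
    linarith
  convert! key using 1
  · ext i
    rcases eq_or_ne i 0 with rfl | hi
    · simp [singleCoeff]
    · have c2 : (((i + 2).choose 2 : ℕ) : ℝ) = (i + 2) * (i + 1) / 2 := by
        rw [Nat.cast_choose_two]
        push_cast
        ring
      simp only [singleCoeff, if_neg hi, c2, Nat.choose_one_right, mul_pow]
      push_cast
      ring
  · rw [singleTerm, shiftInv_eq_inv_div t, ← hh]
    simp only [one_div, ← inv_pow]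
    linear_combination (-6 * h ^ 3) * mul_inv_cancel₀ hne

lemma powerSeries_coeff_zero {d : ℕ → ℝ} {r : ℝ} (hr : 0 < r)
    (h : ∀ t, 0 < t → t ≤ r → HasSum (fun n => d n * t ^ n) 0) : d 0 = 0 := by
  have hs : Summable fun n => |d (n + 1)| * r ^ n := by
    have h1 := ((summable_nat_add_iff 1).2 (h r hr le_rfl).summable).abs.mul_left (r⁻¹)
    refine h1.congr fun n => ?_
    rw [abs_mul, abs_of_pos (pow_pos hr _), pow_succ]
    field_simp
  set K := ∑' n, |d (n + 1)| * r ^ n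
  have bound : ∀ t, 0 < t → t ≤ r → |d 0| ≤ t * K := by
    intro t h0 ht
    have ht' : Summable fun n => |d (n + 1)| * t ^ n :=
      .of_nonneg_of_le (fun n => by positivity) (fun n => by gcongr) hs
    have h1 : HasSum (fun n => d (n + 1) * t ^ (n + 1)) (-d 0) := by
      have := (hasSum_nat_add_iff' 1).2 (h t h0 ht)
      simpa using this
    have h2 : HasSum (fun n => t * (d (n + 1) * t ^ n)) (-d 0) :=
      h1.congr_fun fun n => by ring
    rw [← abs_neg, ← h2.tsum_eq, tsum_mul_left, abs_mul, abs_of_pos h0]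
    refine mul_le_mul_of_nonneg_left ?_ h0.le
    have h3 : ∀ n, ‖d (n + 1) * t ^ n‖ = |d (n + 1)| * t ^ n := fun n => by
      rw [Real.norm_eq_abs, abs_mul, abs_of_pos (pow_pos h0 n)]
    refine (norm_tsum_le_tsum_norm (ht'.congr fun n => (h3 n).symm)).trans ?_
    simp_rw [h3]
    exact ht'.tsum_le_tsum (fun n => by gcongr) hs
  have lim : Tendsto (fun t : ℝ => t * K) (𝓝[>] 0) (𝓝 0) := by
    have : Tendsto (fun t : ℝ => t * K) (𝓝 0) (𝓝 (0 * K)) := tendsto_id.mul_const K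
    rw [zero_mul] at this
    exact this.mono_left nhdsWithin_le_nhds
  have : |d 0| ≤ 0 := by
    refine ge_of_tendsto lim ?_
    filter_upwards [Ioc_mem_nhdsGT hr] with t ht using bound t ht.1 ht.2
  exact abs_eq_zero.1 (le_antisymm this (abs_nonneg _))

lemma powerSeries_coeff {r : ℝ} (hr : 0 < r) (n : ℕ) : ∀ {d : ℕ → ℝ},
    (∀ t, 0 < t → t ≤ r → HasSum (fun n => d n * t ^ n) 0) → d n = 0 := by
  induction n with
  | zero => exact powerSeries_coeff_zero hr
  | succ n ih =>
    intro d h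
    refine ih (d := fun n => d (n + 1)) fun t h0 ht => ?_
    have h1 := ((hasSum_nat_add_iff' 1).2 (h t h0 ht)).mul_left t⁻¹
    simp only [sum_range_one, powerSeries_coeff_zero hr h, zero_mul, sub_zero, mul_zero] at h1
    refine h1.congr_fun fun n => ?_
    rw [pow_succ]
    field_simp

lemma hasSum_rz {t : ℝ} (h0 : 0 ≤ t) (ht : t < 1) {a : ℝ} (h : HasSum (singleTerm t) a) :
    HasSum (fun i => singleCoeff i * rz (i + 3) * t ^ i) a := by
  have hh := shiftInv_nonneg one_pos
  have hc : ∀ i, 0 ≤ singleCoeff i * t ^ i := fun i =>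
    mul_nonneg (singleCoeff_nonneg i) (pow_nonneg h0 i)
  have hs : ∀ n, 0 ≤ singleTerm t n := fun n =>
    (hasSum_singleTerm h0 ht n).nonneg fun i => mul_nonneg (hc i) (pow_nonneg (hh n) _)
  have hz : ∀ i, (∑' n, ENNReal.ofReal (shiftInv 0 n ^ (i + 3))).toReal = rz (i + 3) := fun i => by
    rw [ENNReal.tsum_toReal_eq fun _ => ENNReal.ofReal_ne_top, rz]
    refine tsum_congr fun n => ?_
    rw [ENNReal.toReal_ofReal (pow_nonneg (hh n) _)]
    rcases Nat.eq_zero_or_pos n with rfl | hn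
    · simp [shiftInv_zero]
    · rw [if_pos hn, shiftInv_pos_eq _ hn.ne', sub_zero, one_div_pow]
  have key : ∑' i, ENNReal.ofReal (singleCoeff i * t ^ i) *
      ∑' n, ENNReal.ofReal (shiftInv 0 n ^ (i + 3)) = ENNReal.ofReal a := by
    simp_rw [← ENNReal.tsum_mul_left, ← ENNReal.ofReal_mul (hc _)]
    rw [ENNReal.tsum_comm, ← h.tsum_eq, ENNReal.ofReal_tsum_of_nonneg hs h.summable]
    refine tsum_congr fun n => ?_
    have := hasSum_singleTerm h0 ht n
    rw [← this.tsum_eq, ENNReal.ofReal_tsum_of_nonneg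
      (fun i => mul_nonneg (hc i) (pow_nonneg (hh n) _)) this.summable]
  have h1 := ENNReal.hasSum_toReal (key.trans_ne ENNReal.ofReal_ne_top)
  rw [← ENNReal.tsum_toReal_eq (ENNReal.ne_top_of_tsum_ne_top
    (key.trans_ne ENNReal.ofReal_ne_top)), key, ENNReal.toReal_ofReal
    (h.nonneg hs)] at h1
  refine h1.congr_fun fun i => ?_
  rw [ENNReal.toReal_mul, hz, ENNReal.toReal_ofReal (hc i)]
  ring

/-- The summand `1 / (k ^ (a + 1) * m ^ (b + 1) * j ^ (c + 1))` of a triple zeta value, which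
vanishes unless `0 < j < m < k`. -/
noncomputable def tripleTerm (q p : ℕ × ℕ × ℕ) : ℝ :=
  if p.2.2 < p.2.1 ∧ p.2.1 < p.1 then
    shiftInv 0 p.1 ^ (q.1 + 1) * (shiftInv 0 p.2.1 ^ (q.2.1 + 1) * shiftInv 0 p.2.2 ^ (q.2.2 + 1))
  else 0

lemma tripleTerm_nonneg (q p : ℕ × ℕ × ℕ) : 0 ≤ tripleTerm q p := by
  have hh := shiftInv_nonneg one_pos
  unfold tripleTerm
  split_ifs
  · exact mul_nonneg (pow_nonneg (hh _) _) (mul_nonneg (pow_nonneg (hh _) _) (pow_nonneg (hh _) _))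
  · exact le_rfl

lemma tsum_tripleTerm (q : ℕ × ℕ × ℕ) :
    (∑' p, ENNReal.ofReal (tripleTerm q p)).toReal = tz (q.1 + 1) (q.2.1 + 1) (q.2.2 + 1) := by
  rw [ENNReal.tsum_toReal_eq fun _ => ENNReal.ofReal_ne_top, tz]
  refine tsum_congr fun ⟨k, m, j⟩ => ?_
  rw [ENNReal.toReal_ofReal (tripleTerm_nonneg _ _)]
  simp only [tripleTerm]
  rcases Nat.eq_zero_or_pos j with rfl | hj
  · simp [shiftInv_zero]
  by_cases h : j < m ∧ m < k
  · rw [if_pos h, if_pos ⟨h.2, h.1, hj⟩, shiftInv_pos_eq _ hj.ne', shiftInv_pos_eq _ (by omega),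
      shiftInv_pos_eq _ (by omega), sub_zero, sub_zero, sub_zero]
    simp only [one_div, mul_inv, inv_pow, mul_assoc]
  · rw [if_neg h, if_neg fun h' => h ⟨h'.2.1, h'.1⟩]

/-- The coefficient of a triple zeta value, up to a factor `2`. -/
noncomputable def tripleCoeff (q : ℕ × ℕ × ℕ) : ℝ := (3 ^ q.1 - 1) * 2 ^ q.2.1

lemma tripleCoeff_nonneg (q : ℕ × ℕ × ℕ) : 0 ≤ tripleCoeff q :=
  mul_nonneg (sub_nonneg.2 (one_le_pow₀ (by norm_num))) (by positivity)

lemma ofReal_psum {x : ℕ → ℝ} (hx : ∀ n, 0 ≤ x n) (n : ℕ) :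
    ENNReal.ofReal (psum x n) = ∑' m, if m < n then ENNReal.ofReal (x m) else 0 := by
  rw [psum, ENNReal.ofReal_sum_of_nonneg fun i _ => hx i,
    tsum_eq_sum (s := range n) fun m hm => if_neg (by simpa using hm)]
  exact sum_congr rfl fun m hm => (if_pos (mem_range.1 hm)).symm

lemma ofReal_eq_tsum {x : ℕ → ℝ} {a : ℝ} (hx : ∀ n, 0 ≤ x n) (h : HasSum x a) :
    ENNReal.ofReal a = ∑' n, ENNReal.ofReal (x n) := by
  rw [← h.tsum_eq, ENNReal.ofReal_tsum_of_nonneg hx h.summable]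

lemma tsum_mul_tsum_mul_tsum (x y z : ℕ → ℝ≥0∞) :
    (∑' a, x a) * ((∑' b, y b) * ∑' c, z c) =
      ∑' q : ℕ × ℕ × ℕ, x q.1 * (y q.2.1 * z q.2.2) := by
  simp_rw [ENNReal.tsum_prod', ENNReal.tsum_mul_left, ENNReal.tsum_mul_right]

lemma ofReal_mul_innerSum {t : ℝ} (h0 : 0 ≤ t) (ht : t ≤ 1 / 8) (k : ℕ) :
    ENNReal.ofReal ((shiftInv (3 * t) k - shiftInv t k) * innerSum t k) =
      ∑' r : ℕ × ℕ, ∑' q : ℕ × ℕ × ℕ, ENNReal.ofReal (tripleCoeff q * t ^ (q.1 + q.2.1 + q.2.2)) *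
        ENNReal.ofReal (tripleTerm q (k, r)) := by
  have hh := shiftInv_nonneg one_pos
  have e1 : ∀ j, ENNReal.ofReal (shiftInv t j) =
      ∑' c, ENNReal.ofReal (t ^ c * shiftInv 0 j ^ (c + 1)) := fun j =>
    ofReal_eq_tsum (fun c => mul_nonneg (pow_nonneg h0 _) (pow_nonneg (hh j) _))
      (hasSum_shiftInv h0 (by linarith) j)
  have e2 : ∀ m, ENNReal.ofReal (shiftInv (2 * t) m) =
      ∑' b, ENNReal.ofReal ((2 * t) ^ b * shiftInv 0 m ^ (b + 1)) := fun m =>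
    ofReal_eq_tsum (fun b => mul_nonneg (pow_nonneg (by linarith) _) (pow_nonneg (hh m) _))
      (hasSum_shiftInv (by linarith) (by linarith) m)
  have hd : ∀ a : ℕ, 0 ≤ (3 * t) ^ a * shiftInv 0 k ^ (a + 1) - t ^ a * shiftInv 0 k ^ (a + 1) :=
    fun a => sub_nonneg.2 (mul_le_mul_of_nonneg_right (pow_le_pow_left₀ h0 (by linarith) a)
      (pow_nonneg (hh k) _))
  have hs3 := (hasSum_shiftInv (show 0 ≤ 3 * t by linarith) (by linarith) k).sub
      (hasSum_shiftInv h0 (by linarith) k)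
  have e3 := ofReal_eq_tsum hd hs3
  have p1 := shiftInv_nonneg (show t < 1 by linarith)
  have p2 := shiftInv_nonneg (show 2 * t < 1 by linarith)
  rw [ENNReal.ofReal_mul (hs3.nonneg hd), innerSum,
    ofReal_psum (fun m => mul_nonneg (p2 m) (psum_nonneg p1 m)), ENNReal.tsum_prod',
    ← ENNReal.tsum_mul_left]
  refine tsum_congr fun m => ?_
  by_cases hm : m < k
  swap
  · simp [tripleTerm, hm]
  rw [if_pos hm, ENNReal.ofReal_mul (p2 m), ofReal_psum p1, ← ENNReal.tsum_mul_left,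
    ← ENNReal.tsum_mul_left]
  refine tsum_congr fun j => ?_
  by_cases hj : j < m
  swap
  · simp [tripleTerm, hj]
  rw [if_pos hj, e1, e2, e3, tsum_mul_tsum_mul_tsum]
  refine tsum_congr fun ⟨a, b, c⟩ => ?_
  rw [← ENNReal.ofReal_mul (mul_nonneg (pow_nonneg (by linarith) _) (pow_nonneg (hh m) _)),
    ← ENNReal.ofReal_mul (hd a), ← ENNReal.ofReal_mul
      (mul_nonneg (tripleCoeff_nonneg _) (pow_nonneg h0 _)), tripleTerm, if_pos ⟨hj, hm⟩]
  congr 1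
  simp only [tripleCoeff, mul_pow]
  ring

lemma hasSum_tz {t a : ℝ} (h0 : 0 ≤ t) (ht : t ≤ 1 / 8)
    (h : HasSum (fun k => 6 * ((shiftInv (3 * t) k - shiftInv t k) * innerSum t k)) a) :
    HasSum (fun q : ℕ × ℕ × ℕ => tripleCoeff q * t ^ (q.1 + q.2.1 + q.2.2) *
      tz (q.1 + 1) (q.2.1 + 1) (q.2.2 + 1)) (a / 6) := by
  have hc : ∀ q : ℕ × ℕ × ℕ, 0 ≤ tripleCoeff q * t ^ (q.1 + q.2.1 + q.2.2) := fun q =>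
    mul_nonneg (tripleCoeff_nonneg q) (pow_nonneg h0 _)
  have h' : HasSum (fun k => (shiftInv (3 * t) k - shiftInv t k) * innerSum t k) (a / 6) :=
    (h.div_const 6).congr_fun fun k => by ring
  have hs : ∀ k, 0 ≤ (shiftInv (3 * t) k - shiftInv t k) * innerSum t k := fun k =>
    mul_nonneg (sub_nonneg.2 (shiftInv_mono (by linarith) (by linarith) k)) (innerSum_nonneg ht k)
  have key : ∑' q : ℕ × ℕ × ℕ, ENNReal.ofReal (tripleCoeff q * t ^ (q.1 + q.2.1 + q.2.2)) *
      ∑' p, ENNReal.ofReal (tripleTerm q p) = ENNReal.ofReal (a / 6) := by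
    simp_rw [← ENNReal.tsum_mul_left]
    rw [ENNReal.tsum_comm, ENNReal.tsum_prod', ofReal_eq_tsum hs h']
    exact tsum_congr fun k => (ofReal_mul_innerSum h0 ht k).symm
  have ne := key.trans_ne ENNReal.ofReal_ne_top
  have h1 := ENNReal.hasSum_toReal ne
  rw [← ENNReal.tsum_toReal_eq (ENNReal.ne_top_of_tsum_ne_top ne), key,
    ENNReal.toReal_ofReal (h'.nonneg hs)] at h1
  refine h1.congr_fun fun q => ?_
  rw [ENNReal.toReal_mul, tsum_tripleTerm, ENNReal.toReal_ofReal (hc q)]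

/-- The exponents of weight `n`, shifted so as to start at `0`. -/
def shiftedIdx (n : ℕ) : Finset (ℕ × ℕ × ℕ) :=
  (range (n + 1) ×ˢ range (n + 1) ×ˢ range (n + 1)).filter fun q => q.1 + q.2.1 + q.2.2 = n

lemma mem_shiftedIdx {n : ℕ} {q : ℕ × ℕ × ℕ} : q ∈ shiftedIdx n ↔ q.1 + q.2.1 + q.2.2 = n := by
  simp only [shiftedIdx, mem_filter, mem_product, mem_range, and_iff_right_iff_imp]
  omega

lemma hasSum_weight {f : ℕ × ℕ × ℕ → ℝ} {t a : ℝ}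
    (h : HasSum (fun q : ℕ × ℕ × ℕ => f q * t ^ (q.1 + q.2.1 + q.2.2)) a) :
    HasSum (fun n => (∑ q ∈ shiftedIdx n, f q) * t ^ n) a := by
  refine (h.tsum_fiberwise fun q => q.1 + q.2.1 + q.2.2).congr_fun fun n => ?_
  have : (fun q : ℕ × ℕ × ℕ => q.1 + q.2.1 + q.2.2) ⁻¹' {n} = ↑(shiftedIdx n) := by
    ext q
    simp [mem_shiftedIdx]
  rw [this, Finset.tsum_subtype' (shiftedIdx n)
    fun q : ℕ × ℕ × ℕ => f q * t ^ (q.1 + q.2.1 + q.2.2), sum_mul]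
  exact sum_congr rfl fun q hq => by rw [mem_shiftedIdx.1 hq]

lemma sum_TIdx (n : ℕ) :
    ∑ p ∈ TIdx (n + 3), ((3 : ℝ) ^ (p.1 - 1) - 1) * 2 ^ p.2.1 * tz p.1 p.2.1 p.2.2 =
      2 * ∑ q ∈ shiftedIdx n, tripleCoeff q * tz (q.1 + 1) (q.2.1 + 1) (q.2.2 + 1) := by
  have h : ∑ q ∈ shiftedIdx n, tripleCoeff q * tz (q.1 + 1) (q.2.1 + 1) (q.2.2 + 1) =
      ∑ q ∈ shiftedIdx n with q.1 ≠ 0,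
        tripleCoeff q * tz (q.1 + 1) (q.2.1 + 1) (q.2.2 + 1) := by
    refine (sum_filter_of_ne (p := fun q : ℕ × ℕ × ℕ => q.1 ≠ 0) fun q _ hq h0 => hq ?_).symm
    simp [tripleCoeff, h0]
  rw [h, mul_sum]
  refine sum_nbij' (fun p => (p.1 - 1, p.2.1 - 1, p.2.2 - 1))
    (fun q => (q.1 + 1, q.2.1 + 1, q.2.2 + 1)) ?_ ?_ ?_ ?_ ?_
  · rintro ⟨a, b, c⟩ hp
    simp only [TIdx, mem_filter, mem_shiftedIdx] at hp ⊢
    omega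
  · rintro ⟨a, b, c⟩ hq
    simp only [TIdx, mem_filter, mem_shiftedIdx, mem_product, mem_range] at hq ⊢
    omega
  · rintro ⟨a, b, c⟩ hp
    simp only [TIdx, mem_filter, Prod.mk.injEq] at hp ⊢
    omega
  · intro q _
    rfl
  · rintro ⟨a, b, c⟩ hp
    simp only [TIdx, mem_filter] at hp
    obtain ⟨a, rfl⟩ := Nat.exists_eq_add_of_le' (show 1 ≤ a by omega)
    obtain ⟨b, rfl⟩ := Nat.exists_eq_add_of_le' (show 1 ≤ b by omega)
    obtain ⟨c, rfl⟩ := Nat.exists_eq_add_of_le' (show 1 ≤ c by omega)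
    simp only [tripleCoeff, Nat.add_sub_cancel]
    ring

lemma sum_shiftedIdx (n : ℕ) :
    6 * ∑ q ∈ shiftedIdx n, tripleCoeff q * tz (q.1 + 1) (q.2.1 + 1) (q.2.2 + 1) =
      singleCoeff n * rz (n + 3) := by
  refine sub_eq_zero.1 (powerSeries_coeff (r := 1 / 8) (by norm_num) n (d := fun n =>
    6 * ∑ q ∈ shiftedIdx n, tripleCoeff q * tz (q.1 + 1) (q.2.1 + 1) (q.2.2 + 1) -
      singleCoeff n * rz (n + 3)) fun t h0 ht => ?_)
  obtain ⟨a, h1, h2⟩ := hasSum_innerSum h0.le ht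
  have g1 := (hasSum_weight ((hasSum_tz h0.le ht h1).congr_fun
    (g := fun q : ℕ × ℕ × ℕ => tripleCoeff q * tz (q.1 + 1) (q.2.1 + 1) (q.2.2 + 1) *
      t ^ (q.1 + q.2.1 + q.2.2)) fun q => by ring)).mul_left 6
  have g2 := g1.sub (hasSum_rz h0.le (by linarith) h2)
  rw [mul_div_cancel₀ a (by norm_num), sub_self] at g2
  exact g2.congr_fun fun n => by ring

end TripleZeta

theorem weighted_sum_formula_two (l : ℕ) (hl : 4 ≤ l) :
    (∑ t ∈ TIdx l,
      ((3 : ℝ) ^ (t.1 - 1) - 1) * 2 ^ t.2.1 * tz t.1 t.2.1 t.2.2) =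
      ((l : ℝ) - 1) * ((l : ℝ) + 4) / 6 * rz l := by
  obtain ⟨n, rfl⟩ := Nat.exists_eq_add_of_le' (show 3 ≤ l by omega)
  have h := TripleZeta.sum_shiftedIdx n
  rw [TripleZeta.singleCoeff, if_neg (by omega)] at h
  rw [TripleZeta.sum_TIdx]
  push_cast
  linear_combination (1 / 3) * h
end

section
/- Restricted sum formula of Shen–Cai type: for an even integer l ≥ 4, Σ over l1≥2, l2,l3≥1 with l1+l2+l3=l and l1, l2, l3 all even of ζ(l1,l2,l3) equals (5/8)·ζ(l) - (1/4)·ζ(l-2)·ζ(2). -/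
open Finset

/-- The exponential coefficients `B_k / k!` of the Bernoulli numbers. -/
noncomputable def bernoulliCoeff (k : ℕ) : ℚ := bernoulli k / (k.factorial : ℚ)

lemma bernoulliPowerSeries_sq :
    bernoulliPowerSeries ℚ * bernoulliPowerSeries ℚ =
      bernoulliPowerSeries ℚ - PowerSeries.X * bernoulliPowerSeries ℚ -
        PowerSeries.X * PowerSeries.derivative ℚ (bernoulliPowerSeries ℚ) := by
  have h := bernoulliPowerSeries_mul_exp_sub_one ℚ
  have hd := congrArg (PowerSeries.derivative ℚ) h
  rw [Derivation.leibniz, map_sub, PowerSeries.derivative_exp, PowerSeries.derivative_X,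
    Derivation.map_one_eq_zero, sub_zero, smul_eq_mul, smul_eq_mul] at hd
  linear_combination (bernoulliPowerSeries ℚ) * hd - (bernoulliPowerSeries ℚ) * h -
    PowerSeries.derivative ℚ (bernoulliPowerSeries ℚ) * h

lemma sum_antidiagonal_bernoulliCoeff (n : ℕ) :
    ∑ x ∈ antidiagonal (n + 1), bernoulliCoeff x.1 * bernoulliCoeff x.2 =
      -(n : ℚ) * bernoulliCoeff (n + 1) - bernoulliCoeff n := by
  have h := congrArg (PowerSeries.coeff (n + 1)) bernoulliPowerSeries_sq
  have hc : ∀ k, PowerSeries.coeff k (bernoulliPowerSeries ℚ) = bernoulliCoeff k := by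
    intro k
    simp [bernoulliPowerSeries, bernoulliCoeff]
  rw [PowerSeries.coeff_mul, map_sub, map_sub, PowerSeries.coeff_succ_X_mul,
    PowerSeries.coeff_succ_X_mul, PowerSeries.coeff_derivative] at h
  simp only [hc] at h
  rw [h]
  ring

lemma bernoulliCoeff_eq_zero_of_odd {k : ℕ} (hk : Odd k) (h : 1 < k) : bernoulliCoeff k = 0 := by
  simp [bernoulliCoeff, bernoulli_eq_zero_of_odd hk h]

lemma sum_antidiagonal_bernoulliCoeff_even {n : ℕ} (hn : 2 ≤ n) :
    ∑ x ∈ antidiagonal n, bernoulliCoeff (2 * x.1) * bernoulliCoeff (2 * x.2) =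
      (1 - 2 * (n : ℚ)) * bernoulliCoeff (2 * n) := by
  obtain ⟨m, rfl⟩ : ∃ m, n = m + 1 := ⟨n - 1, by omega⟩
  have h := sum_antidiagonal_bernoulliCoeff (2 * m + 1)
  rw [bernoulliCoeff_eq_zero_of_odd (k := 2 * m + 1) ⟨m, rfl⟩ (by omega)] at h
  have he : ∑ x ∈ antidiagonal (m + 1), bernoulliCoeff (2 * x.1) * bernoulliCoeff (2 * x.2) =
      ∑ x ∈ antidiagonal (2 * m + 1 + 1), bernoulliCoeff x.1 * bernoulliCoeff x.2 := by
    refine Finset.sum_of_injOn (fun x => (2 * x.1, 2 * x.2)) ?_ ?_ ?_ ?_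
    · rintro ⟨a, b⟩ - ⟨c, d⟩ - h
      simp only [Prod.mk.injEq] at h ⊢
      omega
    · rintro ⟨a, b⟩ h
      simp only [mem_coe, HasAntidiagonal.mem_antidiagonal] at h ⊢
      omega
    · rintro ⟨a, b⟩ hab hne
      simp only [HasAntidiagonal.mem_antidiagonal] at hab
      have ha : Odd a := by
        by_contra ha
        rw [Nat.not_odd_iff_even] at ha
        obtain ⟨c, rfl⟩ := ha
        refine hne ⟨(c, m + 1 - c), ?_, ?_⟩
        · simp only [mem_coe, HasAntidiagonal.mem_antidiagonal]
          omega
        · simp only [Prod.mk.injEq]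
          omega
      have hb : Odd b := by
        rw [Nat.odd_iff] at ha ⊢
        omega
      rcases Nat.lt_or_ge 1 a with h1 | h1
      · simp [bernoulliCoeff_eq_zero_of_odd ha h1]
      · simp [bernoulliCoeff_eq_zero_of_odd hb (by omega)]
    · intros
      rfl
  rw [he, h]
  push_cast
  rw [show 2 * m + 1 + 1 = 2 * (m + 1) by ring]
  ring

/-- The value `ζ(2a)`, with the convention that it vanishes at `a = 0`. -/
noncomputable def evenZeta (a : ℕ) : ℝ := if a = 0 then 0 else rz (2 * a)

lemma hasSum_rz {a : ℕ} (ha : a ≠ 0) : HasSum (fun m : ℕ => 1 / (m : ℝ) ^ (2 * a)) (rz (2 * a)) := by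
  have h := (hasSum_zeta_nat ha).summable.hasSum
  convert! h using 1
  unfold rz
  congr 1
  ext m
  rcases Nat.eq_zero_or_pos m with rfl | hm
  · simp [ha]
  · simp [hm]

lemma evenZeta_eq (a : ℕ) :
    evenZeta a = -(1 / 2) * (-4 * Real.pi ^ 2) ^ a * (bernoulliCoeff (2 * a) : ℝ) +
      if a = 0 then 1 / 2 else 0 := by
  rcases a with _ | a
  · simp [evenZeta, bernoulliCoeff]
  · have ha : a + 1 ≠ 0 := a.succ_ne_zero
    rw [evenZeta, if_neg ha, if_neg ha, (hasSum_rz ha).unique (hasSum_zeta_nat ha)]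
    have h4 : (4 : ℝ) ^ (a + 1) = 2 * 2 ^ (2 * a + 1) := by
      rw [show (4 : ℝ) = 2 ^ 2 by norm_num, ← pow_mul]
      ring
    rw [show 2 * (a + 1) - 1 = 2 * a + 1 by omega, bernoulliCoeff, mul_pow, neg_pow (4 : ℝ), h4,
      ← pow_mul]
    push_cast
    ring

lemma sum_antidiagonal_evenZeta {n : ℕ} (hn : 2 ≤ n) :
    ∑ x ∈ antidiagonal n, evenZeta x.1 * evenZeta x.2 = (n + 1 / 2) * evenZeta n := by
  have hB : ∑ x ∈ antidiagonal n, (bernoulliCoeff (2 * x.1) : ℝ) * (bernoulliCoeff (2 * x.2) : ℝ) =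
      (1 - 2 * (n : ℝ)) * (bernoulliCoeff (2 * n) : ℝ) := by
    exact_mod_cast sum_antidiagonal_bernoulliCoeff_even hn
  set z := -4 * Real.pi ^ 2 with hz
  obtain ⟨m, rfl⟩ : ∃ m, n = m + 2 := ⟨n - 2, by omega⟩
  rw [Finset.Nat.sum_antidiagonal_succ, Finset.Nat.sum_antidiagonal_succ'] at hB ⊢
  have hprod : ∀ x ∈ antidiagonal m, evenZeta (x.1 + 1) * evenZeta (x.2 + 1) =
      1 / 4 * z ^ (m + 2) * (bernoulliCoeff (2 * (x.1 + 1)) * bernoulliCoeff (2 * (x.2 + 1))) := by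
    intro x hx
    rw [HasAntidiagonal.mem_antidiagonal] at hx
    rw [evenZeta_eq, evenZeta_eq, if_neg (Nat.succ_ne_zero _), if_neg (Nat.succ_ne_zero _), ← hx]
    ring
  have h0 : bernoulliCoeff 0 = 1 := by simp [bernoulliCoeff]
  have hq : evenZeta 0 = 0 := by simp [evenZeta]
  rw [Finset.sum_congr rfl hprod, ← Finset.mul_sum, hq, evenZeta_eq (m + 2),
    if_neg (Nat.succ_ne_zero _), ← hz]
  simp only [mul_zero, h0] at hB ⊢
  push_cast at hB ⊢
  linear_combination (1 / 4 * z ^ (m + 2)) * hB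

/-- The sum of `f m₁ * g m₂ * h m₃` over all `m₁ > m₂ > m₃`. -/
noncomputable def nestedSum (f g h : ℕ → ℝ) : ℝ :=
  ∑' t : ℕ × ℕ × ℕ, if t.2.1 < t.1 ∧ t.2.2 < t.2.1 then f t.1 * (g t.2.1 * h t.2.2) else 0

lemma summable_mul_mul {f g h : ℕ → ℝ} (hf : Summable f) (hg : Summable g) (hh : Summable h)
    (hf0 : 0 ≤ f) (hg0 : 0 ≤ g) (hh0 : 0 ≤ h) :
    Summable fun t : ℕ × ℕ × ℕ => f t.1 * (g t.2.1 * h t.2.2) :=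
  hf.mul_of_nonneg (hg.mul_of_nonneg hh hg0 hh0) hf0 fun x => mul_nonneg (hg0 x.1) (hh0 x.2)

lemma hasSum_nestedSum {f g h : ℕ → ℝ} (hf : Summable f) (hg : Summable g) (hh : Summable h)
    (hf0 : 0 ≤ f) (hg0 : 0 ≤ g) (hh0 : 0 ≤ h) :
    HasSum (fun t : ℕ × ℕ × ℕ =>
      if t.2.1 < t.1 ∧ t.2.2 < t.2.1 then f t.1 * (g t.2.1 * h t.2.2) else 0)
      (nestedSum f g h) := by
  refine Summable.hasSum ((summable_mul_mul hf hg hh hf0 hg0 hh0).of_nonneg_of_le ?_ ?_)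
  all_goals
    intro t
    have := mul_nonneg (hf0 t.1) (mul_nonneg (hg0 t.2.1) (hh0 t.2.2))
    split_ifs <;> simp [this]

lemma eq_sum_ite_order (x : ℝ) (a b c : ℕ) :
    x = (if b < a ∧ c < b then x else 0) + (if c < a ∧ b < c then x else 0) +
      (if a < b ∧ c < a then x else 0) + (if c < b ∧ a < c then x else 0) +
      (if a < c ∧ b < a then x else 0) + (if b < c ∧ a < b then x else 0) +
      (if a = b then x else 0) + (if a = c then x else 0) + (if b = c then x else 0) -
      2 * (if a = b ∧ b = c then x else 0) := by
  grind (splits := 20)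

/-- Splitting a triple product of series according to the relative order of the indices. -/
lemma sum_perm_nestedSum {f g h : ℕ → ℝ} {F G H FG FH GH FGH : ℝ}
    (hf : HasSum f F) (hg : HasSum g G) (hh : HasSum h H)
    (hfg : HasSum (fun m => f m * g m) FG) (hfh : HasSum (fun m => f m * h m) FH)
    (hgh : HasSum (fun m => g m * h m) GH) (hfgh : HasSum (fun m => f m * (g m * h m)) FGH)
    (hf0 : 0 ≤ f) (hg0 : 0 ≤ g) (hh0 : 0 ≤ h) :
    nestedSum f g h + nestedSum f h g + nestedSum g f h + nestedSum g h f + nestedSum h f g +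
      nestedSum h g f = F * (G * H) - FG * H - FH * G - F * GH + 2 * FGH := by
  have sf := hf.summable
  have sg := hg.summable
  have sh := hh.summable
  have hT : HasSum (fun t : ℕ × ℕ × ℕ => f t.1 * (g t.2.1 * h t.2.2)) (F * (G * H)) :=
    hf.mul (hg.mul hh (sg.mul_of_nonneg sh hg0 hh0)) (summable_mul_mul sf sg sh hf0 hg0 hh0)
  have e1 := hasSum_nestedSum sf sg sh hf0 hg0 hh0
  have e2 := (Equiv.hasSum_iff (⟨fun t => (t.1, t.2.2, t.2.1), fun t => (t.1, t.2.2, t.2.1),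
    fun _ => rfl, fun _ => rfl⟩ : ℕ × ℕ × ℕ ≃ ℕ × ℕ × ℕ)).2
    (hasSum_nestedSum sf sh sg hf0 hh0 hg0)
  have e3 := (Equiv.hasSum_iff (⟨fun t => (t.2.1, t.1, t.2.2), fun t => (t.2.1, t.1, t.2.2),
    fun _ => rfl, fun _ => rfl⟩ : ℕ × ℕ × ℕ ≃ ℕ × ℕ × ℕ)).2
    (hasSum_nestedSum sg sf sh hg0 hf0 hh0)
  have e4 := (Equiv.hasSum_iff (⟨fun t => (t.2.1, t.2.2, t.1), fun t => (t.2.2, t.1, t.2.1),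
    fun _ => rfl, fun _ => rfl⟩ : ℕ × ℕ × ℕ ≃ ℕ × ℕ × ℕ)).2
    (hasSum_nestedSum sg sh sf hg0 hh0 hf0)
  have e5 := (Equiv.hasSum_iff (⟨fun t => (t.2.2, t.1, t.2.1), fun t => (t.2.1, t.2.2, t.1),
    fun _ => rfl, fun _ => rfl⟩ : ℕ × ℕ × ℕ ≃ ℕ × ℕ × ℕ)).2
    (hasSum_nestedSum sh sf sg hh0 hf0 hg0)
  have e6 := (Equiv.hasSum_iff (⟨fun t => (t.2.2, t.2.1, t.1), fun t => (t.2.2, t.2.1, t.1),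
    fun _ => rfl, fun _ => rfl⟩ : ℕ × ℕ × ℕ ≃ ℕ × ℕ × ℕ)).2
    (hasSum_nestedSum sh sg sf hh0 hg0 hf0)
  have d12 : HasSum (fun t : ℕ × ℕ × ℕ =>
      if t.1 = t.2.1 then f t.1 * (g t.2.1 * h t.2.2) else 0) (FG * H) := by
    have hi : Function.Injective fun x : ℕ × ℕ => (x.1, x.1, x.2) := by
      rintro ⟨a, b⟩ ⟨c, d⟩ h
      simp_all
    refine (hi.hasSum_iff ?_).1 ?_
    · rintro ⟨a, b, c⟩ hx
      refine if_neg fun hab => hx ⟨(a, c), ?_⟩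
      simp_all
    · simpa [Function.comp_def, mul_assoc] using
        hfg.mul hh (hfg.summable.mul_of_nonneg sh (fun m => mul_nonneg (hf0 m) (hg0 m)) hh0)
  have d13 : HasSum (fun t : ℕ × ℕ × ℕ =>
      if t.1 = t.2.2 then f t.1 * (g t.2.1 * h t.2.2) else 0) (FH * G) := by
    have hi : Function.Injective fun x : ℕ × ℕ => (x.1, x.2, x.1) := by
      rintro ⟨a, b⟩ ⟨c, d⟩ h
      simp_all
    refine (hi.hasSum_iff ?_).1 ?_
    · rintro ⟨a, b, c⟩ hx
      refine if_neg fun hab => hx ⟨(a, b), ?_⟩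
      simp_all
    · simpa [Function.comp_def, mul_assoc, mul_comm (g _) (h _)] using
        hfh.mul hg (hfh.summable.mul_of_nonneg sg (fun m => mul_nonneg (hf0 m) (hh0 m)) hg0)
  have d23 : HasSum (fun t : ℕ × ℕ × ℕ =>
      if t.2.1 = t.2.2 then f t.1 * (g t.2.1 * h t.2.2) else 0) (F * GH) := by
    have hi : Function.Injective fun x : ℕ × ℕ => (x.1, x.2, x.2) := by
      rintro ⟨a, b⟩ ⟨c, d⟩ h
      simp_all
    refine (hi.hasSum_iff ?_).1 ?_
    · rintro ⟨a, b, c⟩ hx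
      refine if_neg fun hab => hx ⟨(a, b), ?_⟩
      simp_all
    · simpa [Function.comp_def] using
        hf.mul hgh (sf.mul_of_nonneg hgh.summable hf0 (fun m => mul_nonneg (hg0 m) (hh0 m)))
  have d123 : HasSum (fun t : ℕ × ℕ × ℕ =>
      if t.1 = t.2.1 ∧ t.2.1 = t.2.2 then f t.1 * (g t.2.1 * h t.2.2) else 0) FGH := by
    have hi : Function.Injective fun x : ℕ => (x, x, x) := by
      intro a b h
      simp_all
    refine (hi.hasSum_iff ?_).1 ?_
    · rintro ⟨a, b, c⟩ hx
      refine if_neg fun hab => hx ⟨a, ?_⟩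
      simp_all
    · simpa [Function.comp_def] using hfgh
  have hall := ((((((((e1.add e2).add e3).add e4).add e5).add e6).add d12).add d13).add d23).sub
    (d123.mul_left 2)
  have hu := hT.unique (by
    convert! hall using 1
    ext ⟨a, b, c⟩
    simp only [Function.comp_apply, Equiv.coe_fn_mk]
    rw [show f a * (h c * g b) = f a * (g b * h c) by ring,
      show g b * (f a * h c) = f a * (g b * h c) by ring,
      show g b * (h c * f a) = f a * (g b * h c) by ring,
      show h c * (f a * g b) = f a * (g b * h c) by ring,
      show h c * (g b * f a) = f a * (g b * h c) by ring]
    exact eq_sum_ite_order _ a b c)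
  linear_combination -hu

/-- The function `m ↦ m ^ (-2a)`. -/
noncomputable def invEvenPow (a : ℕ) (m : ℕ) : ℝ := 1 / (m : ℝ) ^ (2 * a)

lemma invEvenPow_nonneg (a : ℕ) : 0 ≤ invEvenPow a := fun m => by
  unfold invEvenPow
  positivity

lemma invEvenPow_mul (a b m : ℕ) : invEvenPow a m * invEvenPow b m = invEvenPow (a + b) m := by
  simp only [invEvenPow]
  rw [mul_add, pow_add, one_div_mul_one_div]

lemma hasSum_invEvenPow {a : ℕ} (ha : a ≠ 0) : HasSum (invEvenPow a) (evenZeta a) := by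
  rw [evenZeta, if_neg ha]
  exact hasSum_rz ha

lemma tz_eq_nestedSum {a b c : ℕ} (hc : c ≠ 0) :
    tz (2 * a) (2 * b) (2 * c) = nestedSum (invEvenPow a) (invEvenPow b) (invEvenPow c) := by
  unfold tz nestedSum invEvenPow
  congr 1
  ext ⟨x, y, z⟩
  rcases Nat.eq_zero_or_pos z with rfl | hz
  · simp [hc]
  · simp only [hz, and_true]
    congr 1
    rw [one_div_mul_one_div, one_div_mul_one_div, mul_assoc]

lemma sum_perm_nestedSum_invEvenPow {a b c : ℕ} (ha : a ≠ 0) (hb : b ≠ 0) (hc : c ≠ 0) :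
    nestedSum (invEvenPow a) (invEvenPow b) (invEvenPow c) +
      nestedSum (invEvenPow a) (invEvenPow c) (invEvenPow b) +
      nestedSum (invEvenPow b) (invEvenPow a) (invEvenPow c) +
      nestedSum (invEvenPow b) (invEvenPow c) (invEvenPow a) +
      nestedSum (invEvenPow c) (invEvenPow a) (invEvenPow b) +
      nestedSum (invEvenPow c) (invEvenPow b) (invEvenPow a) =
    evenZeta a * (evenZeta b * evenZeta c) - evenZeta (a + b) * evenZeta c -
      evenZeta (a + c) * evenZeta b - evenZeta a * evenZeta (b + c) +
      2 * evenZeta (a + (b + c)) := by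
  refine sum_perm_nestedSum (hasSum_invEvenPow ha) (hasSum_invEvenPow hb) (hasSum_invEvenPow hc)
    ?_ ?_ ?_ ?_ (invEvenPow_nonneg a) (invEvenPow_nonneg b) (invEvenPow_nonneg c)
  all_goals
    simp only [invEvenPow_mul]
    exact hasSum_invEvenPow (by omega)

/-- The triples of positive integers with sum `n`. -/
def posTriples (n : ℕ) : Finset (ℕ × ℕ × ℕ) :=
  (range (n + 1) ×ˢ range (n + 1) ×ˢ range (n + 1)).filter
    (fun t => 1 ≤ t.1 ∧ 1 ≤ t.2.1 ∧ 1 ≤ t.2.2 ∧ t.1 + t.2.1 + t.2.2 = n)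

lemma mem_posTriples {n : ℕ} {t : ℕ × ℕ × ℕ} :
    t ∈ posTriples n ↔ 1 ≤ t.1 ∧ 1 ≤ t.2.1 ∧ 1 ≤ t.2.2 ∧ t.1 + t.2.1 + t.2.2 = n := by
  simp only [posTriples, mem_filter, mem_product, mem_range]
  omega

lemma sum_posTriples_swap_left (n : ℕ) (φ : ℕ → ℕ → ℕ → ℝ) :
    ∑ t ∈ posTriples n, φ t.2.1 t.1 t.2.2 = ∑ t ∈ posTriples n, φ t.1 t.2.1 t.2.2 := by
  refine sum_nbij' (fun t => (t.2.1, t.1, t.2.2)) (fun t => (t.2.1, t.1, t.2.2)) ?_ ?_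
    (fun _ _ => rfl) (fun _ _ => rfl) (fun _ _ => rfl)
  all_goals
    intro t ht
    rw [mem_posTriples] at ht ⊢
    dsimp only
    omega

lemma sum_posTriples_swap_right (n : ℕ) (φ : ℕ → ℕ → ℕ → ℝ) :
    ∑ t ∈ posTriples n, φ t.1 t.2.2 t.2.1 = ∑ t ∈ posTriples n, φ t.1 t.2.1 t.2.2 := by
  refine sum_nbij' (fun t => (t.1, t.2.2, t.2.1)) (fun t => (t.1, t.2.2, t.2.1)) ?_ ?_
    (fun _ _ => rfl) (fun _ _ => rfl) (fun _ _ => rfl)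
  all_goals
    intro t ht
    rw [mem_posTriples] at ht ⊢
    dsimp only
    omega

lemma sum_posTriples_eq (n : ℕ) (φ : ℕ → ℕ → ℕ → ℝ) :
    ∑ t ∈ posTriples n, φ t.1 t.2.1 t.2.2 =
      ∑ x ∈ antidiagonal n, ∑ y ∈ antidiagonal x.1,
        if 1 ≤ y.1 ∧ 1 ≤ y.2 ∧ 1 ≤ x.2 then φ y.1 y.2 x.2 else 0 := by
  rw [sum_sigma', ← sum_filter]
  refine sum_nbij' (fun t => ⟨(t.1 + t.2.1, t.2.2), (t.1, t.2.1)⟩)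
    (fun p => (p.2.1, p.2.2, p.1.2)) ?_ ?_ ?_ ?_ ?_
  · intro t ht
    rw [mem_posTriples] at ht
    simp only [mem_filter, mem_sigma, HasAntidiagonal.mem_antidiagonal]
    exact ⟨⟨ht.2.2.2, trivial⟩, ht.1, ht.2.1, ht.2.2.1⟩
  · rintro ⟨x, y⟩ hp
    simp only [mem_filter, mem_sigma, HasAntidiagonal.mem_antidiagonal] at hp
    rw [mem_posTriples]
    dsimp only
    omega
  · intros
    rfl
  · rintro ⟨⟨x1, x2⟩, ⟨y1, y2⟩⟩ hp
    simp only [mem_filter, mem_sigma, HasAntidiagonal.mem_antidiagonal] at hp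
    obtain ⟨⟨-, rfl⟩, -⟩ := hp
    rfl
  · intros
    rfl

lemma evenZeta_zero : evenZeta 0 = 0 := by simp [evenZeta]

lemma sum_antidiagonal_evenZeta_all (n : ℕ) :
    ∑ x ∈ antidiagonal n, evenZeta x.1 * evenZeta x.2 =
      (n + 1 / 2) * evenZeta n - if n = 1 then 3 / 2 * evenZeta 1 else 0 := by
  rcases Nat.lt_or_ge n 2 with h | h
  · interval_cases n
    · simp [evenZeta_zero]
    · rw [Finset.Nat.sum_antidiagonal_succ]
      norm_num [evenZeta_zero]
  · rw [sum_antidiagonal_evenZeta h, if_neg (by omega), sub_zero]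

lemma sum_antidiagonal_mul_evenZeta {n : ℕ} (hn : 2 ≤ n) :
    ∑ x ∈ antidiagonal n, (x.1 : ℝ) * (evenZeta x.1 * evenZeta x.2) =
      n / 2 * ((n + 1 / 2) * evenZeta n) := by
  have hs := Finset.Nat.sum_antidiagonal_swap (n := n)
    (f := fun x => (x.1 : ℝ) * (evenZeta x.1 * evenZeta x.2))
  have ha : ∑ x ∈ antidiagonal n, (x.1 : ℝ) * (evenZeta x.1 * evenZeta x.2) +
      ∑ x ∈ antidiagonal n, (x.2 : ℝ) * (evenZeta x.2 * evenZeta x.1) =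
      n * ((n + 1 / 2) * evenZeta n) := by
    rw [← sum_antidiagonal_evenZeta hn, mul_sum, ← sum_add_distrib]
    refine sum_congr rfl fun x hx => ?_
    rw [HasAntidiagonal.mem_antidiagonal] at hx
    rw [← hx]
    push_cast
    ring
  simp only [Prod.fst_swap, Prod.snd_swap] at hs
  linarith

lemma sum_antidiagonal_pos_const (d : ℕ) (c : ℝ) :
    ∑ y ∈ antidiagonal d, (if 1 ≤ y.1 ∧ 1 ≤ y.2 then c else 0) =
      (d - 1 + if d = 0 then 1 else 0) * c := by
  rcases d with _ | _ | d
  · simp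
  · simp [Finset.Nat.sum_antidiagonal_succ]
  · rw [Finset.Nat.sum_antidiagonal_succ, Finset.Nat.sum_antidiagonal_succ']
    simp

lemma sum_posTriples_mul_mul {n : ℕ} (hn : 2 ≤ n) :
    ∑ t ∈ posTriples n, evenZeta t.1 * (evenZeta t.2.1 * evenZeta t.2.2) =
      (n + 1) / 2 * ((n + 1 / 2) * evenZeta n) - 3 / 2 * (evenZeta 1 * evenZeta (n - 1)) := by
  rw [sum_posTriples_eq n fun a b c => evenZeta a * (evenZeta b * evenZeta c)]
  have h1 : ∀ x ∈ antidiagonal n, (∑ y ∈ antidiagonal x.1,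
      if 1 ≤ y.1 ∧ 1 ≤ y.2 ∧ 1 ≤ x.2 then evenZeta y.1 * (evenZeta y.2 * evenZeta x.2) else 0) =
      (x.1 : ℝ) * (evenZeta x.1 * evenZeta x.2) + 1 / 2 * (evenZeta x.1 * evenZeta x.2) -
        if x.1 = 1 then 3 / 2 * (evenZeta 1 * evenZeta x.2) else 0 := by
    intro x _
    have h2 : (∑ y ∈ antidiagonal x.1,
        if 1 ≤ y.1 ∧ 1 ≤ y.2 ∧ 1 ≤ x.2 then evenZeta y.1 * (evenZeta y.2 * evenZeta x.2) else 0) =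
        (∑ y ∈ antidiagonal x.1, evenZeta y.1 * evenZeta y.2) * evenZeta x.2 := by
      rw [sum_mul]
      refine sum_congr rfl fun y _ => ?_
      split_ifs with h
      · ring
      · have : y.1 = 0 ∨ y.2 = 0 ∨ x.2 = 0 := by omega
        rcases this with h | h | h <;> simp [h, evenZeta_zero]
    rw [h2, sum_antidiagonal_evenZeta_all]
    split_ifs <;> ring
  have h3 : ∑ x ∈ antidiagonal n, (if x.1 = 1 then 3 / 2 * (evenZeta 1 * evenZeta x.2) else 0) =
      3 / 2 * (evenZeta 1 * evenZeta (n - 1)) := by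
    rw [sum_eq_single (1, n - 1)]
    · simp
    · rintro ⟨a, b⟩ hab hne
      rw [HasAntidiagonal.mem_antidiagonal] at hab
      refine if_neg fun h => hne ?_
      simp only [Prod.mk.injEq] at *
      omega
    · intro h
      rw [HasAntidiagonal.mem_antidiagonal] at h
      omega
  rw [sum_congr rfl h1, sum_sub_distrib, sum_add_distrib, ← mul_sum, h3,
    sum_antidiagonal_mul_evenZeta hn, sum_antidiagonal_evenZeta hn]
  ring

lemma sum_posTriples_add_mul {n : ℕ} (hn : 2 ≤ n) :
    ∑ t ∈ posTriples n, evenZeta (t.1 + t.2.1) * evenZeta t.2.2 =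
      (n / 2 - 1) * ((n + 1 / 2) * evenZeta n) := by
  rw [sum_posTriples_eq n fun a b c => evenZeta (a + b) * evenZeta c]
  have h1 : ∀ x ∈ antidiagonal n, (∑ y ∈ antidiagonal x.1,
      if 1 ≤ y.1 ∧ 1 ≤ y.2 ∧ 1 ≤ x.2 then evenZeta (y.1 + y.2) * evenZeta x.2 else 0) =
      (x.1 : ℝ) * (evenZeta x.1 * evenZeta x.2) - evenZeta x.1 * evenZeta x.2 := by
    intro x _
    have h2 : (∑ y ∈ antidiagonal x.1,
        if 1 ≤ y.1 ∧ 1 ≤ y.2 ∧ 1 ≤ x.2 then evenZeta (y.1 + y.2) * evenZeta x.2 else 0) =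
        ∑ y ∈ antidiagonal x.1,
          if 1 ≤ y.1 ∧ 1 ≤ y.2 then evenZeta x.1 * evenZeta x.2 else 0 := by
      refine sum_congr rfl fun y hy => ?_
      rw [HasAntidiagonal.mem_antidiagonal] at hy
      rw [hy]
      rcases Nat.eq_zero_or_pos x.2 with h | h
      · simp [h, evenZeta_zero]
      · simp [Nat.one_le_iff_ne_zero, h.ne']
    rw [h2, sum_antidiagonal_pos_const]
    split_ifs with h
    · simp [h, evenZeta_zero]
    · ring
  rw [sum_congr rfl h1, sum_sub_distrib, sum_antidiagonal_mul_evenZeta hn,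
    sum_antidiagonal_evenZeta hn]
  ring

lemma sum_posTriples_const {n : ℕ} (hn : 1 ≤ n) (c : ℝ) :
    ∑ _t ∈ posTriples n, c = (n - 1) * (n - 2) / 2 * c := by
  rw [sum_posTriples_eq n fun _ _ _ => c]
  obtain ⟨m, rfl⟩ : ∃ m, n = m + 1 := ⟨n - 1, by omega⟩
  rw [Finset.Nat.sum_antidiagonal_succ']
  simp only [Nat.le_add_left, and_true, nonpos_iff_eq_zero, one_ne_zero, and_false, if_false,
    sum_const_zero, sum_antidiagonal_pos_const, zero_add]
  rw [Finset.Nat.sum_antidiagonal_eq_sum_range_succ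
    (fun i _ => ((i : ℝ) - 1 + if i = 0 then 1 else 0) * c)]
  induction m with
  | zero => simp
  | succ m ih =>
    rw [sum_range_succ, ih (by omega), if_neg (Nat.succ_ne_zero _)]
    push_cast
    ring

lemma sum_posTriples_nestedSum {n : ℕ} (hn : 2 ≤ n) :
    ∑ t ∈ posTriples n, nestedSum (invEvenPow t.1) (invEvenPow t.2.1) (invEvenPow t.2.2) =
      5 / 8 * evenZeta n - 1 / 4 * (evenZeta 1 * evenZeta (n - 1)) := by
  have h := sum_congr (rfl : posTriples n = posTriples n) fun t ht =>
    have ht' := mem_posTriples.1 ht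
    sum_perm_nestedSum_invEvenPow (a := t.1) (b := t.2.1) (c := t.2.2) (by omega) (by omega)
      (by omega)
  simp only [sum_add_distrib, sum_sub_distrib, ← mul_sum] at h
  let N : ℕ → ℕ → ℕ → ℝ := fun a b c => nestedSum (invEvenPow a) (invEvenPow b) (invEvenPow c)
  let D : ℕ → ℕ → ℕ → ℝ := fun a b c => evenZeta (a + b) * evenZeta c
  have p1 := sum_posTriples_swap_right n N
  have p2 := sum_posTriples_swap_left n N
  have p3 := sum_posTriples_swap_left n fun a b c => N a c b
  have p4 := sum_posTriples_swap_right n fun a b c => N b a c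
  have p5 := sum_posTriples_swap_left n fun a b c => N c a b
  have d1 := sum_posTriples_swap_right n D
  have d2 := sum_posTriples_swap_left n fun a b c => D a c b
  have d3 : ∑ t ∈ posTriples n, evenZeta t.1 * evenZeta (t.2.1 + t.2.2) =
      ∑ t ∈ posTriples n, evenZeta (t.2.1 + t.2.2) * evenZeta t.1 :=
    sum_congr rfl fun _ _ => mul_comm _ _
  have k : ∑ t ∈ posTriples n, evenZeta (t.1 + (t.2.1 + t.2.2)) =
      (n - 1) * (n - 2) / 2 * evenZeta n := by
    rw [← sum_posTriples_const (by omega)]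
    refine sum_congr rfl fun t ht => ?_
    rw [← add_assoc, (mem_posTriples.1 ht).2.2.2]
  have m := sum_posTriples_mul_mul hn
  have a := sum_posTriples_add_mul hn
  dsimp only [N, D] at p1 p2 p3 p4 p5 d1 d2
  linear_combination (1 / 6) * (h - 2 * p1 - 3 * p2 - p3 - 2 * p4 - p5 - 2 * d1 - d2 - d3 + 2 * k +
    m - 3 * a)

theorem restricted_sum_all_even (l : ℕ) (hl : 4 ≤ l) (hev : Even l) :
    (∑ t ∈ (TIdx l).filter (fun t => Even t.1 ∧ Even t.2.1 ∧ Even t.2.2),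
      tz t.1 t.2.1 t.2.2) = 5 / 8 * rz l - 1 / 4 * rz (l - 2) * rz 2 := by
  obtain ⟨n, rfl⟩ := hev.two_dvd
  have hn : 2 ≤ n := by omega
  have h := sum_posTriples_nestedSum hn
  have e1 : evenZeta 1 = rz 2 := by simp [evenZeta]
  have e2 : evenZeta n = rz (2 * n) := if_neg (by omega)
  have e3 : evenZeta (n - 1) = rz (2 * n - 2) := by
    rw [evenZeta, if_neg (by omega), Nat.mul_sub]
  rw [e1, e2, e3] at h
  rw [mul_assoc, mul_comm (rz (2 * n - 2)), ← h]
  refine sum_nbij' (fun t => (t.1 / 2, t.2.1 / 2, t.2.2 / 2))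
    (fun t => (2 * t.1, 2 * t.2.1, 2 * t.2.2)) ?_ ?_ ?_ ?_ ?_
  · intro t ht
    simp only [TIdx, mem_filter, mem_product, mem_range, Nat.even_iff] at ht
    rw [mem_posTriples]
    dsimp only
    omega
  · intro t ht
    rw [mem_posTriples] at ht
    simp only [TIdx, mem_filter, mem_product, mem_range, Nat.even_iff]
    omega
  · rintro ⟨a, b, c⟩ ht
    simp only [TIdx, mem_filter, mem_product, mem_range, Nat.even_iff] at ht
    simp only [Prod.mk.injEq]
    omega
  · rintro ⟨a, b, c⟩ -
    simp
  · rintro ⟨a, b, c⟩ ht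
    simp only [TIdx, mem_filter, mem_product, mem_range, Nat.even_iff] at ht
    rw [← tz_eq_nestedSum (by dsimp only; omega)]
    dsimp only
    congr 1 <;> omega
end

section
/- For an even integer l ≥ 4, the sum of ζ(l1,l2,l3) over all (l1,l2,l3) with l1 ≥ 2, l2,l3 ≥ 1, l1+l2+l3 = l, and exactly one of l1, l2, l3 even (the other two odd) equals (3/8)·ζ(l) + (1/4)·ζ(l-2)·ζ(2). -/
open Finset in
theorem sum_antidiagonal_two_mul {M : Type*} [AddCommMonoid M] (n : ℕ) (f : ℕ × ℕ → M)
    (hf : ∀ p ∈ antidiagonal (2 * n), Odd p.1 → f p = 0) :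
    ∑ p ∈ antidiagonal (2 * n), f p = ∑ p ∈ antidiagonal n, f (2 * p.1, 2 * p.2) := by
  symm
  apply sum_of_injOn (fun p : ℕ × ℕ => (2 * p.1, 2 * p.2))
  · rintro ⟨a, b⟩ - ⟨c, d⟩ - h
    simp only [Prod.mk.injEq] at h ⊢
    omega
  · rintro ⟨a, b⟩ h
    simp only [mem_coe, HasAntidiagonal.mem_antidiagonal] at h ⊢
    omega
  · rintro ⟨a, b⟩ h h'
    apply hf _ h
    by_contra hodd
    rw [Nat.not_odd_iff_even] at hodd
    obtain ⟨c, hc⟩ := hodd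
    apply h'
    simp only [HasAntidiagonal.mem_antidiagonal] at h
    simp only at hc
    refine ⟨(c, n - c), ?_, ?_⟩
    · simp only [mem_coe, HasAntidiagonal.mem_antidiagonal]; omega
    · simp only [Prod.mk.injEq]; omega
  · intros; rfl

open PowerSeries in
theorem X_mul_derivative_bernoulliPowerSeries :
    X * derivative ℚ (bernoulliPowerSeries ℚ) =
      bernoulliPowerSeries ℚ - X * bernoulliPowerSeries ℚ - bernoulliPowerSeries ℚ ^ 2 := by
  have h := bernoulliPowerSeries_mul_exp_sub_one ℚ
  have h' := congrArg (derivative ℚ) h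
  simp only [Derivation.leibniz, map_sub, derivative_exp, derivative_one, sub_zero, smul_eq_mul,
    derivative_X] at h'
  linear_combination (bernoulliPowerSeries ℚ) * h' -
    (derivative ℚ (bernoulliPowerSeries ℚ) + bernoulliPowerSeries ℚ) * h

open Finset in
theorem sum_antidiagonal_bernoulli (s : ℕ) :
    ∑ p ∈ antidiagonal s, (bernoulli (2 * (p.1 + 1)) / (2 * (p.1 + 1)).factorial) *
      (bernoulli (2 * (p.2 + 1)) / (2 * (p.2 + 1)).factorial) =
      -(2 * s + 5) * (bernoulli (2 * (s + 2)) / (2 * (s + 2)).factorial) := by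
  have h := congrArg (PowerSeries.coeff (2 * (s + 2))) X_mul_derivative_bernoulliPowerSeries
  have e : 2 * (s + 2) = (2 * s + 3) + 1 := by ring
  rw [e, PowerSeries.coeff_succ_X_mul, PowerSeries.coeff_derivative, map_sub, map_sub,
    PowerSeries.coeff_succ_X_mul, ← e, pow_two, PowerSeries.coeff_mul] at h
  simp only [bernoulliPowerSeries, PowerSeries.coeff_mk, Algebra.algebraMap_self, RingHom.id_apply]
    at h
  rw [bernoulli_eq_zero_of_odd (n := 2 * s + 3) ⟨s + 1, by ring⟩ (by omega),
    sum_antidiagonal_two_mul, Nat.sum_antidiagonal_succ, Nat.sum_antidiagonal_succ'] at h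
  · simp only [mul_zero, bernoulli_zero, Nat.factorial_zero, Nat.cast_one] at h
    push_cast at h
    linear_combination h
  · rintro ⟨a, b⟩ hab ha
    simp only [HasAntidiagonal.mem_antidiagonal] at hab ha ⊢
    obtain ⟨c, rfl⟩ := ha
    rcases Nat.eq_zero_or_pos c with rfl | hc
    · rw [bernoulli_eq_zero_of_odd (n := b) ⟨s + 1, by omega⟩ (by omega)]
      simp
    · rw [bernoulli_eq_zero_of_odd (n := 2 * c + 1) ⟨c, rfl⟩ (by omega)]
      simp

theorem rz_two_mul {k : ℕ} (hk : k ≠ 0) :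
    rz (2 * k) = (-1 : ℝ) ^ (k + 1) * (2 : ℝ) ^ (2 * k - 1) * Real.pi ^ (2 * k) *
        bernoulli (2 * k) / (2 * k).factorial := by
  rw [← (hasSum_zeta_nat hk).tsum_eq, rz]
  congr with m
  rcases m with _ | m
  · simp [hk]
  · simp

open Finset in
theorem sum_antidiagonal_rz_mul_rz (s : ℕ) :
    ∑ p ∈ antidiagonal s, rz (2 * (p.1 + 1)) * rz (2 * (p.2 + 1)) =
      (s + 5 / 2) * rz (2 * (s + 2)) := by
  have h := congrArg (fun q : ℚ => (q : ℝ)) (sum_antidiagonal_bernoulli s)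
  push_cast at h
  rw [rz_two_mul (by omega)]
  have e : ∀ p ∈ antidiagonal s, rz (2 * (p.1 + 1)) * rz (2 * (p.2 + 1)) =
      (-1 : ℝ) ^ s * 2 ^ (2 * s + 2) * Real.pi ^ (2 * (s + 2)) *
      ((bernoulli (2 * (p.1 + 1)) / (2 * (p.1 + 1)).factorial) *
      (bernoulli (2 * (p.2 + 1)) / (2 * (p.2 + 1)).factorial)) := by
    rintro ⟨a, b⟩ hab
    simp only [HasAntidiagonal.mem_antidiagonal] at hab
    subst hab
    rw [rz_two_mul (by omega), rz_two_mul (by omega),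
      show 2 * (a + 1) - 1 = 2 * a + 1 by omega, show 2 * (b + 1) - 1 = 2 * b + 1 by omega]
    ring
  rw [sum_congr rfl e, ← mul_sum, h, show 2 * (s + 2) - 1 = 2 * s + 3 by omega]
  ring

open Finset in
/-- The triples of natural numbers with sum `N`. -/
def triples (N : ℕ) : Finset (ℕ × ℕ × ℕ) :=
  (range (N + 1) ×ˢ range (N + 1) ×ˢ range (N + 1)).filter (fun t => t.1 + t.2.1 + t.2.2 = N)

theorem mem_triples {N : ℕ} {t : ℕ × ℕ × ℕ} : t ∈ triples N ↔ t.1 + t.2.1 + t.2.2 = N := by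
  simp only [triples, Finset.mem_filter, Finset.mem_product, Finset.mem_range]
  omega

section
variable {M : Type*} [AddCommMonoid M]

theorem sum_triples_swap_left (N : ℕ) (f : ℕ → ℕ → ℕ → M) :
    ∑ t ∈ triples N, f t.2.1 t.1 t.2.2 = ∑ t ∈ triples N, f t.1 t.2.1 t.2.2 := by
  apply Finset.sum_nbij' (fun t => (t.2.1, t.1, t.2.2)) (fun t => (t.2.1, t.1, t.2.2)) <;>
    simp only [mem_triples, implies_true] <;> intros <;> omega

theorem sum_triples_swap_right (N : ℕ) (f : ℕ → ℕ → ℕ → M) :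
    ∑ t ∈ triples N, f t.1 t.2.2 t.2.1 = ∑ t ∈ triples N, f t.1 t.2.1 t.2.2 := by
  apply Finset.sum_nbij' (fun t => (t.1, t.2.2, t.2.1)) (fun t => (t.1, t.2.2, t.2.1)) <;>
    simp only [mem_triples, implies_true] <;> intros <;> omega

open Finset in
theorem sum_triples (N : ℕ) (f : ℕ → ℕ → ℕ → M) :
    ∑ t ∈ triples N, f t.1 t.2.1 t.2.2 =
      ∑ x ∈ antidiagonal N, ∑ y ∈ antidiagonal x.1, f y.1 y.2 x.2 := by
  rw [sum_sigma']
  apply sum_nbij' (fun t => ⟨(t.1 + t.2.1, t.2.2), (t.1, t.2.1)⟩)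
    (fun x => (x.2.1, x.2.2, x.1.2))
  · rintro ⟨a, b, c⟩ h
    simpa [mem_triples] using h
  · rintro ⟨⟨a, b⟩, c, d⟩ h
    simp only [mem_sigma, HasAntidiagonal.mem_antidiagonal, mem_triples] at h ⊢
    omega
  · rintro ⟨a, b, c⟩ _
    rfl
  · rintro ⟨⟨a, b⟩, c, d⟩ h
    simp only [mem_sigma, HasAntidiagonal.mem_antidiagonal] at h
    obtain ⟨-, rfl⟩ := h
    rfl
  · rintro ⟨a, b, c⟩ _
    rfl

end

section
variable (p : ℕ → ℝ)

open Finset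

theorem sum_antidiagonal_fst_mul (N : ℕ) :
    ∑ x ∈ antidiagonal N, (x.1 : ℝ) * (p (x.1 + 1) * p (x.2 + 1)) =
      N / 2 * ∑ x ∈ antidiagonal N, p (x.1 + 1) * p (x.2 + 1) := by
  have h : ∑ x ∈ antidiagonal N, (x.1 : ℝ) * (p (x.1 + 1) * p (x.2 + 1)) =
      ∑ x ∈ antidiagonal N, (x.2 : ℝ) * (p (x.1 + 1) * p (x.2 + 1)) := by
    rw [← Nat.sum_antidiagonal_swap]
    exact sum_congr rfl fun x _ => by simp only [Prod.fst_swap, Prod.snd_swap]; ring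
  have h' : ∑ x ∈ antidiagonal N, (x.1 : ℝ) * (p (x.1 + 1) * p (x.2 + 1)) +
      ∑ x ∈ antidiagonal N, (x.2 : ℝ) * (p (x.1 + 1) * p (x.2 + 1)) =
      N * ∑ x ∈ antidiagonal N, p (x.1 + 1) * p (x.2 + 1) := by
    rw [← sum_add_distrib, mul_sum]
    refine sum_congr rfl fun x hx => ?_
    rw [← HasAntidiagonal.mem_antidiagonal.mp hx]
    push_cast
    ring
  linarith

variable {p}

theorem sum_triples_add_mul
    (hp : ∀ s : ℕ, ∑ x ∈ antidiagonal s, p (x.1 + 1) * p (x.2 + 1) = (s + 5 / 2) * p (s + 2))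
    (N : ℕ) :
    ∑ t ∈ triples N, p (t.1 + t.2.1 + 2) * p (t.2.2 + 1) =
      (N + 1) / 2 * (N + 7 / 2) * p (N + 3) := by
  have h := sum_antidiagonal_fst_mul p (N + 1)
  rw [hp, Nat.sum_antidiagonal_succ] at h
  rw [sum_triples N fun a b c => p (a + b + 2) * p (c + 1)]
  push_cast at h
  trans ∑ x ∈ antidiagonal N, ((x.1 : ℝ) + 1) * (p (x.1 + 1 + 1) * p (x.2 + 1))
  · refine sum_congr rfl fun x _ => ?_
    trans ∑ y ∈ antidiagonal x.1, p (x.1 + 2) * p (x.2 + 1)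
    · exact sum_congr rfl fun y hy => by rw [HasAntidiagonal.mem_antidiagonal.mp hy]
    · rw [sum_const, Nat.card_antidiagonal, nsmul_eq_mul]
      push_cast
      ring
  · rw [show N + 1 + 2 = N + 3 by ring] at h
    linear_combination h

theorem sum_triples_mul_mul
    (hp : ∀ s : ℕ, ∑ x ∈ antidiagonal s, p (x.1 + 1) * p (x.2 + 1) = (s + 5 / 2) * p (s + 2))
    (N : ℕ) :
    ∑ t ∈ triples N, p (t.1 + 1) * p (t.2.1 + 1) * p (t.2.2 + 1) =
      (N + 4) / 2 * (N + 7 / 2) * p (N + 3) - 3 / 2 * (p 1 * p (N + 2)) := by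
  have h := sum_antidiagonal_fst_mul p (N + 1)
  have h₂ := hp (N + 1)
  rw [h₂, Nat.sum_antidiagonal_succ] at h
  rw [Nat.sum_antidiagonal_succ] at h₂
  rw [sum_triples N fun a b c => p (a + 1) * p (b + 1) * p (c + 1)]
  simp_rw [← sum_mul, hp]
  push_cast at h h₂
  have e : ∑ x ∈ antidiagonal N, ((x.1 : ℝ) + 5 / 2) * p (x.1 + 2) * p (x.2 + 1) =
      ∑ x ∈ antidiagonal N, ((x.1 : ℝ) + 1) * (p (x.1 + 1 + 1) * p (x.2 + 1)) +
      3 / 2 * ∑ x ∈ antidiagonal N, p (x.1 + 1 + 1) * p (x.2 + 1) := by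
    rw [mul_sum, ← sum_add_distrib]
    exact sum_congr rfl fun x _ => by ring
  rw [show N + 1 + 2 = N + 3 by ring] at h h₂
  rw [show N + 1 + 1 = N + 2 by ring] at h₂
  rw [e]
  linear_combination h + 3 / 2 * h₂

theorem card_triples (N : ℕ) : ((triples N).card : ℝ) = (N + 1) * (N + 2) / 2 := by
  have h := sum_triples N fun _ _ _ => 1
  rw [← card_eq_sum_ones] at h
  rw [h]
  simp only [sum_const, Nat.card_antidiagonal, smul_eq_mul, mul_one]
  rw [Nat.sum_antidiagonal_eq_sum_range_succ (fun i _ => i + 1)]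
  clear h
  induction N with
  | zero => simp
  | succ n ih =>
    rw [sum_range_succ]
    push_cast at ih ⊢
    rw [ih]
    ring

end

open ENNReal

/-- The summand `n⁻ᵉ` of a multiple zeta series, set to zero at `n = 0`. -/
noncomputable def zetaTerm (e n : ℕ) : ℝ≥0∞ :=
  ENNReal.ofReal (if 0 < n then 1 / (n : ℝ) ^ e else 0)

theorem zetaTerm_mul (a b n : ℕ) : zetaTerm a n * zetaTerm b n = zetaTerm (a + b) n := by
  unfold zetaTerm
  split_ifs with h
  · rw [← ENNReal.ofReal_mul (by positivity), pow_add]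
    congr 1
    field_simp
  · simp

/-- The zeta value as an extended nonnegative real. -/
noncomputable def ezeta (e : ℕ) : ℝ≥0∞ := ∑' n, zetaTerm e n

/-- The triple zeta value as an extended nonnegative real. -/
noncomputable def etriple (a b c : ℕ) : ℝ≥0∞ :=
  ∑' (i) (j) (k), if j < i ∧ k < j then zetaTerm a i * zetaTerm b j * zetaTerm c k else 0

theorem ezeta_mul_mul_add (a b c : ℕ) :
    ezeta a * ezeta b * ezeta c + 2 * ezeta (a + b + c) =
      etriple a b c + etriple a c b + etriple b a c + etriple b c a + etriple c a b +
        etriple c b a + ezeta (a + b) * ezeta c + ezeta (a + c) * ezeta b +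
        ezeta (b + c) * ezeta a := by
  have h₁ : ezeta a * ezeta b * ezeta c =
      ∑' (i) (j) (k), zetaTerm a i * zetaTerm b j * zetaTerm c k := by
    simp_rw [ezeta, ENNReal.tsum_mul_left, ENNReal.tsum_mul_right, ENNReal.tsum_mul_left,
      ENNReal.tsum_mul_right]
  have h₂ : 2 * ezeta (a + b + c) = ∑' (i) (j) (k), if i = j then if j = k then
      2 * (zetaTerm a i * zetaTerm b j * zetaTerm c k) else 0 else 0 := by
    simp_rw [ezeta, ← ENNReal.tsum_mul_left, ← zetaTerm_mul]
    congr with i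
    rw [tsum_eq_single i (by intro j hj; simp [hj.symm]),
      tsum_eq_single i (by intro j hj; simp [hj.symm])]
    simp
  have h₃ : ezeta (a + b) * ezeta c = ∑' (i) (j) (k), if i = j then
      zetaTerm a i * zetaTerm b j * zetaTerm c k else 0 := by
    simp_rw [ezeta, ← ENNReal.tsum_mul_right, ← zetaTerm_mul]
    congr with i
    conv_rhs => rw [tsum_eq_single i (by intro j hj; simp [hj.symm])]
    simp [ENNReal.tsum_mul_left]
  have h₄ : ezeta (a + c) * ezeta b = ∑' (i) (j) (k), if i = k then
      zetaTerm a i * zetaTerm b j * zetaTerm c k else 0 := by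
    simp_rw [ezeta, ← ENNReal.tsum_mul_right, ← zetaTerm_mul, ← ENNReal.tsum_mul_left]
    congr with i
    congr with j
    rw [tsum_eq_single i (by intro j hj; simp [hj.symm])]
    simp only [if_true]
    ring
  have h₅ : ezeta (b + c) * ezeta a = ∑' (i) (j) (k), if j = k then
      zetaTerm a i * zetaTerm b j * zetaTerm c k else 0 := by
    rw [mul_comm]
    simp_rw [ezeta, ← ENNReal.tsum_mul_right, ← zetaTerm_mul, ← ENNReal.tsum_mul_left]
    congr with i
    congr with j
    rw [tsum_eq_single j (by intro j hj; simp [hj.symm])]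
    simp only [if_true]
    ring
  have e₁ : etriple a c b = ∑' (i) (j) (k), if k < i ∧ j < k then
      zetaTerm a i * zetaTerm b j * zetaTerm c k else 0 := by
    rw [etriple]
    congr with i
    rw [ENNReal.tsum_comm]
    simp_rw [mul_right_comm]
  have e₂ : etriple b a c = ∑' (i) (j) (k), if i < j ∧ k < i then
      zetaTerm a i * zetaTerm b j * zetaTerm c k else 0 := by
    rw [etriple, ENNReal.tsum_comm]
    simp_rw [mul_comm (zetaTerm b _)]
  have e₃ : etriple b c a = ∑' (i) (j) (k), if k < j ∧ i < k then
      zetaTerm a i * zetaTerm b j * zetaTerm c k else 0 := by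
    rw [etriple]
    trans ∑' (j) (i) (k), if k < j ∧ i < k then zetaTerm a i * zetaTerm b j * zetaTerm c k else 0
    · congr with j
      rw [ENNReal.tsum_comm]
      congr with i
      congr with k
      simp_rw [mul_rotate (zetaTerm a i)]
    · rw [ENNReal.tsum_comm]
  have e₄ : etriple c a b = ∑' (i) (j) (k), if i < k ∧ j < i then
      zetaTerm a i * zetaTerm b j * zetaTerm c k else 0 := by
    rw [etriple, ENNReal.tsum_comm]
    congr with i
    rw [ENNReal.tsum_comm]
    congr with j
    congr with k
    simp_rw [← mul_rotate (zetaTerm c k)]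
  have e₅ : etriple c b a = ∑' (i) (j) (k), if j < k ∧ i < j then
      zetaTerm a i * zetaTerm b j * zetaTerm c k else 0 := by
    rw [etriple]
    trans ∑' (k) (i) (j), if j < k ∧ i < j then zetaTerm a i * zetaTerm b j * zetaTerm c k else 0
    · congr with k
      rw [ENNReal.tsum_comm]
      congr with i
      congr with j
      congr 1
      ring
    · rw [ENNReal.tsum_comm]
      congr with i
      rw [ENNReal.tsum_comm]
  rw [h₁, h₂, h₃, h₄, h₅, e₁, e₂, e₃, e₄, e₅, etriple]
  simp_rw [← ENNReal.tsum_add]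
  congr with i
  congr with j
  congr with k
  generalize zetaTerm a i * zetaTerm b j * zetaTerm c k = z
  rcases lt_trichotomy i j with h | h | h <;> rcases lt_trichotomy j k with h' | h' | h' <;>
    rcases lt_trichotomy i k with h'' | h'' | h'' <;> first | omega | skip
  all_goals simp (discharger := omega) only [if_pos, if_neg, add_zero, zero_add]
  ring

theorem toReal_ezeta (e : ℕ) :
    (ezeta e).toReal = ∑' m : ℕ, if 0 < m then 1 / (m : ℝ) ^ e else 0 := by
  rw [ezeta, ENNReal.tsum_toReal_eq fun _ => by exact ENNReal.ofReal_ne_top]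
  congr with n
  exact ENNReal.toReal_ofReal (by positivity)

theorem toReal_etriple (a b c : ℕ) :
    (etriple a b c).toReal =
      ∑' t : ℕ × ℕ × ℕ, if t.2.1 < t.1 ∧ t.2.2 < t.2.1 ∧ 0 < t.2.2 then
        1 / ((t.1 : ℝ) ^ a * (t.2.1 : ℝ) ^ b * (t.2.2 : ℝ) ^ c) else 0 := by
  trans (∑' t : ℕ × ℕ × ℕ, if t.2.1 < t.1 ∧ t.2.2 < t.2.1 then
    zetaTerm a t.1 * zetaTerm b t.2.1 * zetaTerm c t.2.2 else 0).toReal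
  · simp_rw [etriple, ENNReal.tsum_prod']
  rw [ENNReal.tsum_toReal_eq]
  · congr with t
    by_cases h : t.2.1 < t.1 ∧ t.2.2 < t.2.1 ∧ 0 < t.2.2
    · rw [if_pos h, if_pos ⟨h.1, h.2.1⟩]
      simp only [zetaTerm, h.2.2, h.2.2.trans h.2.1, (h.2.2.trans h.2.1).trans h.1, if_true,
        toReal_mul]
      rw [toReal_ofReal (by positivity), toReal_ofReal (by positivity),
        toReal_ofReal (by positivity)]
      field_simp
    · rw [if_neg h]
      split_ifs with h'
      · have : t.2.2 = 0 := by omega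
        simp [this, zetaTerm]
      · rfl
  · intro t
    split_ifs
    · exact mul_ne_top (mul_ne_top ofReal_ne_top ofReal_ne_top) ofReal_ne_top
    · exact zero_ne_top

theorem ezeta_ne_top {e : ℕ} (he : 2 ≤ e) : ezeta e ≠ ⊤ := by
  have h : Summable fun m : ℕ => if 0 < m then 1 / (m : ℝ) ^ e else 0 := by
    refine (Real.summable_one_div_nat_pow.mpr (show 1 < e by omega)).of_nonneg_of_le
      (fun n => by positivity) fun n => ?_
    split_ifs
    · exact le_rfl
    · positivity
  rw [ezeta]
  unfold zetaTerm
  rw [← ofReal_tsum_of_nonneg (fun n => by positivity) h]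
  exact ofReal_ne_top

/-- The shifted summand `1 / (n - x)`, set to zero at `n = 0`. -/
noncomputable def shiftedTerm (x : ℝ) (n : ℕ) : ℝ≥0∞ :=
  ENNReal.ofReal (if 0 < n then 1 / (n - x) else 0)

theorem tsum_pow_mul_zetaTerm {x : ℝ} (hx₀ : 0 < x) (hx₁ : x < 1) (n : ℕ) :
    ∑' a, ENNReal.ofReal x ^ a * zetaTerm (a + 1) n = shiftedTerm x n := by
  unfold zetaTerm shiftedTerm
  split_ifs with h
  · have hn : (1 : ℝ) ≤ n := by exact_mod_cast h
    have hs := (hasSum_geometric_of_lt_one (r := x / n) (by positivity)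
      ((div_lt_one (by linarith)).mpr (by linarith))).mul_left (1 / (n : ℝ))
    have e : ∀ a : ℕ, ENNReal.ofReal x ^ a * ENNReal.ofReal (1 / (n : ℝ) ^ (a + 1)) =
        ENNReal.ofReal (1 / n * (x / n) ^ a) := by
      intro a
      rw [← ofReal_pow hx₀.le, ← ofReal_mul (by positivity), div_pow, pow_succ]
      congr 1
      field_simp
    simp_rw [e]
    rw [← ofReal_tsum_of_nonneg (fun a => by positivity) hs.summable, hs.tsum_eq]
    congr 1
    have : (n : ℝ) - x ≠ 0 := by linarith
    field_simp
  · simp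

theorem tsum_pow_mul_zetaTerm_add {x : ℝ} (hx₀ : 0 < x) (hx₁ : x < 1) (e n : ℕ) :
    ∑' a, ENNReal.ofReal x ^ a * zetaTerm (a + (e + 1)) n = shiftedTerm x n * zetaTerm e n := by
  rw [← tsum_pow_mul_zetaTerm hx₀ hx₁, ← ENNReal.tsum_mul_right]
  congr with a
  rw [mul_assoc, zetaTerm_mul, add_assoc, add_comm 1 e]

/-- The shifted factorial `(1 - x) (2 - x) ⋯ (n - x)`. -/
noncomputable def shiftedFactorial (x : ℝ) (n : ℕ) : ℝ := ∏ i ∈ Finset.range n, ((i : ℝ) + 1 - x)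

theorem shiftedFactorial_succ (x : ℝ) (n : ℕ) :
    shiftedFactorial x (n + 1) = shiftedFactorial x n * (n + 1 - x) := by
  rw [shiftedFactorial, Finset.prod_range_succ, shiftedFactorial]

theorem shiftedFactorial_pos {x : ℝ} (hx₁ : x < 1) (n : ℕ) : 0 < shiftedFactorial x n :=
  Finset.prod_pos fun i _ => by
    have : (0 : ℝ) ≤ i := i.cast_nonneg
    linarith

/-- The connector of Seki and Yamamoto. -/
noncomputable def connector (x : ℝ) (m n : ℕ) : ℝ :=
  shiftedFactorial x m * shiftedFactorial x n / shiftedFactorial x (m + n)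

theorem connector_comm (x : ℝ) (m n : ℕ) : connector x m n = connector x n m := by
  rw [connector, connector, mul_comm, add_comm]

theorem connector_zero_left {x : ℝ} (hx₁ : x < 1) (n : ℕ) : connector x 0 n = 1 := by
  have := (shiftedFactorial_pos hx₁ n).ne'
  rw [connector, zero_add, shiftedFactorial, Finset.prod_range_zero, one_mul, div_self this]

theorem connector_pos {x : ℝ} (hx₁ : x < 1) (m n : ℕ) : 0 < connector x m n :=
  div_pos (mul_pos (shiftedFactorial_pos hx₁ m) (shiftedFactorial_pos hx₁ n))
    (shiftedFactorial_pos hx₁ _)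

theorem connector_sub_connector_succ {x : ℝ} (hx₁ : x < 1) (m n : ℕ) :
    connector x m n - connector x (m + 1) n = n * (connector x (m + 1) n / (m + 1 - x)) := by
  have h₁ := (shiftedFactorial_pos hx₁ (m + n)).ne'
  have h₂ : (m : ℝ) + 1 - x ≠ 0 := by
    have : (0 : ℝ) ≤ m := m.cast_nonneg
    linarith
  have h₃ : (m : ℝ) + n + 1 - x ≠ 0 := by
    have : (0 : ℝ) ≤ m := m.cast_nonneg
    have : (0 : ℝ) ≤ n := n.cast_nonneg
    linarith
  simp only [connector, shiftedFactorial_succ, add_right_comm m 1 n]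
  push_cast
  field_simp
  ring

open Filter Topology in
theorem tendsto_connector {x : ℝ} (hx₀ : 0 < x) (hx₁ : x < 1) (k n : ℕ) :
    Tendsto (fun m : ℕ => connector x (m + k) (n + 1)) atTop (𝓝 0) := by
  have hlim : Tendsto (fun m : ℕ => shiftedFactorial x (n + 1) * (1 / ((m : ℝ) + 1 - x)))
      atTop (𝓝 0) := by
    rw [← mul_zero (shiftedFactorial x (n + 1))]
    refine Tendsto.const_mul _ ?_
    simp_rw [one_div, add_sub_assoc]
    exact tendsto_inv_atTop_zero.comp
      (tendsto_atTop_add_const_right _ _ tendsto_natCast_atTop_atTop)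
  have hle : ∀ m, connector x m (n + 1) ≤ shiftedFactorial x (n + 1) * (1 / ((m : ℝ) + 1 - x)) := by
    intro m
    have hm : (0 : ℝ) ≤ m := m.cast_nonneg
    have hmono : ∀ r : ℕ, shiftedFactorial x (m + 1) ≤ shiftedFactorial x (m + (r + 1)) := by
      intro r
      induction r with
      | zero => exact le_rfl
      | succ r ih =>
        refine ih.trans ?_
        rw [← add_assoc m (r + 1) 1, shiftedFactorial_succ x (m + (r + 1))]
        refine le_mul_of_one_le_right (shiftedFactorial_pos hx₁ _).le ?_
        have : (0 : ℝ) ≤ r := r.cast_nonneg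
        push_cast
        linarith
    replace hmono := hmono n
    have hp := shiftedFactorial_pos hx₁ (m + 1)
    have hq := shiftedFactorial_pos hx₁ (n + 1)
    have hr := shiftedFactorial_pos hx₁ m
    have hd : 0 < (m : ℝ) + 1 - x := by linarith
    rw [connector, mul_one_div, div_le_div_iff₀ (hp.trans_le hmono) hd]
    rw [shiftedFactorial_succ] at hmono
    nlinarith
  exact squeeze_zero (fun m => (connector_pos hx₁ _ _).le) (fun m => hle (m + k))
    ((tendsto_add_atTop_iff_nat k).mpr hlim)

theorem hasSum_connector {x : ℝ} (hx₀ : 0 < x) (hx₁ : x < 1) (k n : ℕ) :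
    HasSum (fun i : ℕ => connector x (i + k + 1) (n + 1) / ((i + k : ℕ) + 1 - x))
      (connector x k (n + 1) / (n + 1)) := by
  rw [hasSum_iff_tendsto_nat_of_nonneg]
  · have hsum : ∀ N : ℕ, ∑ i ∈ Finset.range N,
        connector x (i + k + 1) (n + 1) / ((i + k : ℕ) + 1 - x) =
        (connector x k (n + 1) - connector x (N + k) (n + 1)) / (n + 1) := by
      intro N
      rw [_root_.eq_div_iff (by positivity)]
      induction N with
      | zero => simp
      | succ N ih =>
        have h := connector_sub_connector_succ hx₁ (N + k) (n + 1)
        rw [Finset.sum_range_succ, add_mul, ih, add_right_comm N 1 k]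
        push_cast at h ⊢
        linear_combination -h
    simp_rw [hsum]
    simpa using ((tendsto_connector hx₀ hx₁ k n).const_sub
      (connector x k (n + 1))).div_const ((n : ℝ) + 1)
  · intro i
    refine div_nonneg (connector_pos hx₁ _ _).le ?_
    have : (0 : ℝ) ≤ (i + k : ℕ) := Nat.cast_nonneg _
    linarith

/-- Transport relation for the connector. -/
theorem tsum_shiftedTerm_mul_connector {x : ℝ} (hx₀ : 0 < x) (hx₁ : x < 1) (k : ℕ) {n : ℕ}
    (hn : 0 < n) :
    ∑' j, (if k < j then shiftedTerm x j * ENNReal.ofReal (connector x j n) else 0) =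
      ENNReal.ofReal (connector x k n) * zetaTerm 1 n := by
  obtain ⟨n, rfl⟩ : ∃ m, n = m + 1 := ⟨n - 1, by omega⟩
  have hs := hasSum_connector hx₀ hx₁ k n
  rw [← Summable.sum_add_tsum_nat_add' (k := k + 1) ENNReal.summable, Finset.sum_eq_zero, zero_add]
  · trans ∑' i : ℕ, ENNReal.ofReal (connector x (i + k + 1) (n + 1) / ((i + k : ℕ) + 1 - x))
    · congr with i
      have : (0 : ℝ) ≤ (i + k : ℕ) := Nat.cast_nonneg _
      rw [if_pos (by omega), shiftedTerm, if_pos (by omega), ← ofReal_mul, ← add_assoc]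
      · congr 1
        push_cast
        ring
      · rw [← add_assoc]
        push_cast at this ⊢
        exact div_nonneg zero_le_one (by linarith)
    rw [← ofReal_tsum_of_nonneg, hs.tsum_eq, zetaTerm, if_pos (by omega), ← ofReal_mul]
    · congr 1
      push_cast
      ring
    · exact (connector_pos hx₁ _ _).le
    · intro i
      refine div_nonneg (connector_pos hx₁ _ _).le ?_
      have : (0 : ℝ) ≤ (i + k : ℕ) := Nat.cast_nonneg _
      linarith
    · exact hs.summable
  · intro i hi
    rw [Finset.mem_range] at hi
    rw [if_neg (by omega)]

/-- The connected sum over one variable `n`, linked to `j`. -/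
noncomputable def connectedSum (x : ℝ) (e j : ℕ) : ℝ≥0∞ :=
  ∑' n, shiftedTerm x n * zetaTerm e n * ENNReal.ofReal (connector x j n)

theorem tsum_shiftedTerm_mul_connectedSum {x : ℝ} (hx₀ : 0 < x) (hx₁ : x < 1) (e k : ℕ) :
    ∑' j, (if k < j then shiftedTerm x j * connectedSum x e j else 0) =
      connectedSum x (e + 1) k := by
  unfold connectedSum
  trans ∑' (j) (n), shiftedTerm x n * zetaTerm e n *
    (if k < j then shiftedTerm x j * ENNReal.ofReal (connector x j n) else 0)
  · congr with j
    split_ifs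
    · rw [← ENNReal.tsum_mul_left]
      congr with n
      ring
    · simp
  · rw [ENNReal.tsum_comm]
    congr with n
    rw [ENNReal.tsum_mul_left]
    rcases Nat.eq_zero_or_pos n with rfl | hn
    · simp [shiftedTerm]
    · rw [tsum_shiftedTerm_mul_connector hx₀ hx₁ k hn, ← zetaTerm_mul]
      ring

theorem connectedSum_zero_left {x : ℝ} (hx₀ : 0 < x) (hx₁ : x < 1) {j : ℕ} (hj : 0 < j) :
    connectedSum x 0 j = zetaTerm 1 j := by
  have h := tsum_shiftedTerm_mul_connector hx₀ hx₁ 0 hj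
  rw [connector_zero_left hx₁, ofReal_one, one_mul] at h
  rw [← h, connectedSum]
  congr with n
  rcases Nat.eq_zero_or_pos n with rfl | hn
  · simp [shiftedTerm]
  · simp [hn, zetaTerm, connector_comm x j]

theorem connectedSum_zero_right {x : ℝ} (hx₁ : x < 1) (e : ℕ) :
    connectedSum x e 0 = ∑' n, shiftedTerm x n * zetaTerm e n := by
  simp [connectedSum, connector_zero_left hx₁]

theorem tsum_shifted_triple {x : ℝ} (hx₀ : 0 < x) (hx₁ : x < 1) :
    ∑' (i) (j) (k), (if j < i ∧ k < j then
      shiftedTerm x i * zetaTerm 1 i * shiftedTerm x j * shiftedTerm x k else 0) =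
      ∑' n, shiftedTerm x n * zetaTerm 3 n := by
  rw [← connectedSum_zero_right hx₁, ← tsum_shiftedTerm_mul_connectedSum hx₀ hx₁]
  simp_rw [← tsum_shiftedTerm_mul_connectedSum hx₀ hx₁ 1,
    ← tsum_shiftedTerm_mul_connectedSum hx₀ hx₁ 0]
  trans ∑' (k) (j) (i), (if j < i ∧ k < j then
      shiftedTerm x i * zetaTerm 1 i * shiftedTerm x j * shiftedTerm x k else 0)
  · rw [ENNReal.tsum_comm, tsum_congr fun j => ENNReal.tsum_comm, ENNReal.tsum_comm]
  · congr with k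
    split_ifs with hk
    · rw [← ENNReal.tsum_mul_left]
      congr with j
      split_ifs with hj
      · rw [← ENNReal.tsum_mul_left, ← ENNReal.tsum_mul_left]
        congr with i
        simp only [hj, and_true]
        split_ifs with hi
        · rw [connectedSum_zero_left hx₀ hx₁ (by omega)]
          ring
        · simp
      · simp [hj]
    · obtain rfl : k = 0 := by omega
      simp [shiftedTerm]
theorem tsum_sum_triples (f : ℕ × ℕ × ℕ → ℝ≥0∞) :
    ∑' N, ∑ t ∈ triples N, f t = ∑' t, f t := by
  trans ∑' (N) (t : ℕ × ℕ × ℕ), if t.1 + t.2.1 + t.2.2 = N then f t else 0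
  · congr with N
    rw [tsum_eq_sum (s := triples N) fun t ht => if_neg (mt mem_triples.mpr ht)]
    exact Finset.sum_congr rfl fun t ht => (if_pos (mem_triples.mp ht)).symm
  · rw [ENNReal.tsum_comm]
    congr with t
    rw [tsum_eq_single (t.1 + t.2.1 + t.2.2) fun N hN => if_neg hN.symm, if_pos rfl]

theorem tsum_pow_mul_sum_etriple {x : ℝ} (hx₀ : 0 < x) (hx₁ : x < 1) :
    ∑' N, ENNReal.ofReal x ^ N * ∑ t ∈ triples N, etriple (t.1 + 2) (t.2.1 + 1) (t.2.2 + 1) =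
      ∑' N, ENNReal.ofReal x ^ N * ezeta (N + 4) := by
  have hr : ∑' N, ENNReal.ofReal x ^ N * ezeta (N + 4) = ∑' n, shiftedTerm x n * zetaTerm 3 n := by
    simp_rw [ezeta, ← ENNReal.tsum_mul_left]
    rw [ENNReal.tsum_comm]
    simp_rw [tsum_pow_mul_zetaTerm_add hx₀ hx₁ 3]
  rw [hr, ← tsum_shifted_triple hx₀ hx₁]
  trans ∑' t : ℕ × ℕ × ℕ, ∑' s : ℕ × ℕ × ℕ, if s.2.1 < s.1 ∧ s.2.2 < s.2.1 then
    (ENNReal.ofReal x ^ t.1 * zetaTerm (t.1 + 2) s.1) *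
      ((ENNReal.ofReal x ^ t.2.1 * zetaTerm (t.2.1 + 1) s.2.1) *
      (ENNReal.ofReal x ^ t.2.2 * zetaTerm (t.2.2 + 1) s.2.2)) else 0
  · rw [← tsum_sum_triples]
    congr with N
    rw [Finset.mul_sum]
    refine Finset.sum_congr rfl fun t ht => ?_
    simp_rw [etriple, ENNReal.tsum_prod', ← ENNReal.tsum_mul_left]
    congr with i
    congr with j
    congr with k
    rw [← mem_triples.mp ht, mul_ite_zero]
    congr 1
    ring
  · rw [ENNReal.tsum_comm, ENNReal.tsum_prod']
    congr with i
    rw [ENNReal.tsum_prod']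
    congr with j
    congr with k
    split_ifs
    · simp only [ENNReal.tsum_prod', ENNReal.tsum_mul_left, ENNReal.tsum_mul_right]
      rw [tsum_pow_mul_zetaTerm hx₀ hx₁, tsum_pow_mul_zetaTerm hx₀ hx₁, tsum_pow_mul_zetaTerm_add hx₀ hx₁ 1]
      ring
    · simp

theorem tsum_pow_mul_eq_zero_add (y : ℝ≥0∞) (a : ℕ → ℝ≥0∞) :
    ∑' k, y ^ k * a k = a 0 + y * ∑' k, y ^ k * a (k + 1) := by
  rw [tsum_eq_zero_add' ENNReal.summable, ← ENNReal.tsum_mul_left]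
  simp_rw [pow_succ', mul_assoc]
  simp

open Filter Topology in
theorem coeff_zero_le_of_tsum_eq {a b : ℕ → ℝ≥0∞}
    (hb : ∑' k, ENNReal.ofReal (1 / 2) ^ k * b k ≠ ⊤)
    (h : ∀ x : ℝ, 0 < x → x < 1 →
      ∑' k, ENNReal.ofReal x ^ k * a k = ∑' k, ENNReal.ofReal x ^ k * b k) : a 0 ≤ b 0 := by
  set R := ∑' k, ENNReal.ofReal (1 / 2) ^ k * b (k + 1) with hR
  have hRt : R ≠ ⊤ := by
    intro hRt
    rw [tsum_pow_mul_eq_zero_add, ← hR, hRt, mul_top (by simp)] at hb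
    simp at hb
  have hlim : Tendsto (fun x : ℝ => b 0 + ENNReal.ofReal x * R) (𝓝[>] 0) (𝓝 (b 0)) := by
    have h₁ : Tendsto (fun x : ℝ => ENNReal.ofReal x) (𝓝[>] 0) (𝓝 0) := by
      simpa using (ENNReal.continuous_ofReal.tendsto 0).mono_left nhdsWithin_le_nhds
    simpa using (ENNReal.Tendsto.mul_const h₁ (Or.inr hRt)).const_add (b 0)
  refine ge_of_tendsto hlim ?_
  filter_upwards [Ioo_mem_nhdsGT (show (0 : ℝ) < 1 / 2 by norm_num)] with x hx
  calc a 0 ≤ ∑' k, ENNReal.ofReal x ^ k * a k := by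
        rw [tsum_pow_mul_eq_zero_add]
        exact le_self_add
    _ = b 0 + ENNReal.ofReal x * ∑' k, ENNReal.ofReal x ^ k * b (k + 1) := by
        rw [h x hx.1 (by linarith [hx.2]), tsum_pow_mul_eq_zero_add]
    _ ≤ b 0 + ENNReal.ofReal x * R := by
        have := hx.2.le
        rw [hR]
        gcongr

theorem coeff_eq_of_tsum_eq (k : ℕ) {a b : ℕ → ℝ≥0∞}
    (hb : ∑' k, ENNReal.ofReal (1 / 2) ^ k * b k ≠ ⊤)
    (h : ∀ x : ℝ, 0 < x → x < 1 →
      ∑' k, ENNReal.ofReal x ^ k * a k = ∑' k, ENNReal.ofReal x ^ k * b k) : a k = b k := by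
  have h₀ : a 0 = b 0 := by
    refine le_antisymm (coeff_zero_le_of_tsum_eq hb h)
      (coeff_zero_le_of_tsum_eq ?_ fun x hx₀ hx₁ => (h x hx₀ hx₁).symm)
    rwa [h _ (by norm_num) (by norm_num)]
  induction k generalizing a b with
  | zero => exact h₀
  | succ k ih =>
    rw [tsum_pow_mul_eq_zero_add] at hb
    have hb₀ : b 0 ≠ ⊤ := fun ht => by simp [ht] at hb
    have hb' : ∑' k, ENNReal.ofReal (1 / 2) ^ k * b (k + 1) ≠ ⊤ := by
      intro ht
      rw [ht, mul_top (by simp)] at hb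
      simp at hb
    have h' : ∀ x : ℝ, 0 < x → x < 1 → ∑' k, ENNReal.ofReal x ^ k * a (k + 1) =
        ∑' k, ENNReal.ofReal x ^ k * b (k + 1) := by
      intro x hx₀ hx₁
      have hx := h x hx₀ hx₁
      rw [tsum_pow_mul_eq_zero_add _ a, tsum_pow_mul_eq_zero_add _ b, h₀,
        ENNReal.add_right_inj hb₀,
        ENNReal.mul_right_inj (by simpa using hx₀) ofReal_ne_top] at hx
      exact hx
    refine ih (a := fun k => a (k + 1)) (b := fun k => b (k + 1)) hb' h' ?_
    refine le_antisymm (coeff_zero_le_of_tsum_eq hb' h')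
      (coeff_zero_le_of_tsum_eq ?_ fun x hx₀ hx₁ => (h' x hx₀ hx₁).symm)
    rwa [h' _ (by norm_num) (by norm_num)]

theorem ezeta_le_ezeta {d e : ℕ} (h : d ≤ e) : ezeta e ≤ ezeta d := by
  refine ENNReal.tsum_le_tsum fun n => ofReal_le_ofReal ?_
  split_ifs with hn
  · have : (1 : ℝ) ≤ n := by exact_mod_cast hn
    gcongr
  · exact le_rfl

/-- The sum formula for triple zeta values. -/
theorem sum_etriple (N : ℕ) :
    ∑ t ∈ triples N, etriple (t.1 + 2) (t.2.1 + 1) (t.2.2 + 1) = ezeta (N + 4) := by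
  refine coeff_eq_of_tsum_eq N
    (a := fun N => ∑ t ∈ triples N, etriple (t.1 + 2) (t.2.1 + 1) (t.2.2 + 1))
    (b := fun N => ezeta (N + 4)) ?_ fun x hx₀ hx₁ => tsum_pow_mul_sum_etriple hx₀ hx₁
  refine ne_top_of_le_ne_top (b := ∑' k : ℕ, ENNReal.ofReal (1 / 2) ^ k * ezeta 2) ?_ ?_
  · rw [ENNReal.tsum_mul_right, ENNReal.tsum_geometric]
    refine mul_ne_top ?_ (ezeta_ne_top le_rfl)
    simp
  · refine ENNReal.tsum_le_tsum fun k => ?_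
    gcongr
    exact ezeta_le_ezeta (by omega)

theorem etriple_ne_top (a b c : ℕ) : etriple (a + 2) (b + 1) (c + 1) ≠ ⊤ := by
  refine ne_top_of_le_ne_top (ezeta_ne_top (e := a + b + c + 4) (by omega)) ?_
  rw [← sum_etriple]
  have hmem : (a, b, c) ∈ triples (a + b + c) := mem_triples.mpr rfl
  have h := Finset.single_le_sum_of_canonicallyOrdered
    (f := fun t : ℕ × ℕ × ℕ => etriple (t.1 + 2) (t.2.1 + 1) (t.2.2 + 1)) hmem
  exact h

theorem rz_eq_toReal (e : ℕ) : rz e = (ezeta e).toReal := (toReal_ezeta e).symm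

theorem tz_eq_toReal (a b c : ℕ) : tz a b c = (etriple a b c).toReal :=
  (toReal_etriple a b c).symm

/-- The symmetric sum of a triple zeta value in terms of zeta values. -/
theorem rz_mul_mul_add (a b c : ℕ) :
    rz (a + 2) * rz (b + 2) * rz (c + 2) + 2 * rz (a + b + c + 6) =
      tz (a + 2) (b + 2) (c + 2) + tz (a + 2) (c + 2) (b + 2) + tz (b + 2) (a + 2) (c + 2) +
      tz (b + 2) (c + 2) (a + 2) + tz (c + 2) (a + 2) (b + 2) + tz (c + 2) (b + 2) (a + 2) +
      rz (a + b + 4) * rz (c + 2) + rz (a + c + 4) * rz (b + 2) + rz (b + c + 4) * rz (a + 2) := by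
  have hz : ∀ e, ezeta (e + 2) ≠ ⊤ := fun e => ezeta_ne_top (by omega)
  have ht : ∀ a b c, etriple (a + 2) (b + 2) (c + 2) ≠ ⊤ :=
    fun a b c => etriple_ne_top a (b + 1) (c + 1)
  have h := congrArg ENNReal.toReal (ezeta_mul_mul_add (a + 2) (b + 2) (c + 2))
  rw [show a + 2 + (b + 2) + (c + 2) = a + b + c + 4 + 2 by ring,
    show a + 2 + (b + 2) = a + b + 2 + 2 by ring, show a + 2 + (c + 2) = a + c + 2 + 2 by ring,
    show b + 2 + (c + 2) = b + c + 2 + 2 by ring] at h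
  have hm : ∀ d e, ezeta (d + 2) * ezeta (e + 2) ≠ ⊤ := fun d e => mul_ne_top (hz d) (hz e)
  rw [toReal_add (mul_ne_top (hm _ _) (hz _)) (mul_ne_top (by simp) (hz _))] at h
  repeat rw [toReal_add (by simp only [ne_eq, add_eq_top, ht, hm, or_self, not_false_iff])
    (by simp only [ne_eq, ht, hm, not_false_iff])] at h
  simpa only [rz_eq_toReal, tz_eq_toReal, toReal_mul, toReal_ofNat] using h

open Finset in
/-- The sum formula for triple zeta values at even arguments. -/
theorem sum_tz_even (N : ℕ) :
    ∑ t ∈ triples N, tz (2 * (t.1 + 1)) (2 * (t.2.1 + 1)) (2 * (t.2.2 + 1)) =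
      5 / 8 * rz (2 * (N + 3)) - 1 / 4 * (rz 2 * rz (2 * (N + 2))) := by
  set p : ℕ → ℝ := fun k => rz (2 * k) with hp
  have hE : ∀ s : ℕ, ∑ x ∈ antidiagonal s, p (x.1 + 1) * p (x.2 + 1) = (s + 5 / 2) * p (s + 2) :=
    sum_antidiagonal_rz_mul_rz
  set T : ℕ → ℕ → ℕ → ℝ := fun a b c => tz (2 * (a + 1)) (2 * (b + 1)) (2 * (c + 1)) with hT
  have hst : ∀ a b c : ℕ, p (a + 1) * p (b + 1) * p (c + 1) + 2 * p (a + b + c + 3) =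
      T a b c + T a c b + T b a c + T b c a + T c a b + T c b a + p (a + b + 2) * p (c + 1) +
      p (a + c + 2) * p (b + 1) + p (b + c + 2) * p (a + 1) := by
    intro a b c
    have := rz_mul_mul_add (2 * a) (2 * b) (2 * c)
    simp only [hp, hT, mul_add, mul_one]
    exact this
  have hs := sum_congr (rfl : triples N = triples N) fun t _ => hst t.1 t.2.1 t.2.2
  simp only [sum_add_distrib] at hs
  have h₃ : ∑ t ∈ triples N, 2 * p (t.1 + t.2.1 + t.2.2 + 3) =
      (N + 1) * (N + 2) * p (N + 3) := by
    trans ∑ t ∈ triples N, 2 * p (N + 3)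
    · exact sum_congr rfl fun t ht => by rw [mem_triples.mp ht]
    · rw [sum_const, nsmul_eq_mul, card_triples]
      ring
  have c₁ := sum_triples_swap_right N T
  have c₂ := sum_triples_swap_left N T
  have c₃ := sum_triples_swap_left N fun a b c => T a c b
  have c₄ := sum_triples_swap_right N fun a b c => T b a c
  have c₅ := sum_triples_swap_right N fun a b c => T b c a
  have d₁ := sum_triples_swap_right N fun a b c => p (a + b + 2) * p (c + 1)
  have d₂ := sum_triples_swap_left N fun a b c => p (a + c + 2) * p (b + 1)
  have hp₁ := sum_triples_add_mul hE N
  have hp₂ := sum_triples_mul_mul hE N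
  have e₁ : rz 2 = p 1 := rfl
  have e₂ : rz (2 * (N + 2)) = p (N + 2) := rfl
  have e₃ : rz (2 * (N + 3)) = p (N + 3) := rfl
  rw [e₁, e₂, e₃]
  change ∑ t ∈ triples N, T t.1 t.2.1 t.2.2 = _
  linear_combination (-hs - (3 * c₁ + 2 * c₂ + 2 * c₃ + c₄ + c₅) - (2 * d₁ + d₂) -
    3 * hp₁ + hp₂ + h₃) / 6

open Finset in
/-- The sum formula for triple zeta values. -/
theorem sum_tz_TIdx (N : ℕ) : ∑ t ∈ TIdx (N + 4), tz t.1 t.2.1 t.2.2 = rz (N + 4) := by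
  rw [rz_eq_toReal, ← sum_etriple, toReal_sum fun t _ => etriple_ne_top _ _ _]
  simp_rw [← tz_eq_toReal]
  symm
  apply sum_nbij' (fun t => (t.1 + 2, t.2.1 + 1, t.2.2 + 1))
    (fun t => (t.1 - 2, t.2.1 - 1, t.2.2 - 1)) <;>
    simp only [mem_triples, TIdx, mem_filter, mem_product, mem_range, implies_true] <;>
    rintro ⟨a, b, c⟩ h <;> simp only [Prod.mk.injEq] at h ⊢ <;> omega

theorem restricted_sum_one_even (l : ℕ) (hl : 4 ≤ l) (hev : Even l) :
    (∑ t ∈ (TIdx l).filter (fun t =>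
        (Even t.1 ∧ Odd t.2.1 ∧ Odd t.2.2) ∨ (Odd t.1 ∧ Even t.2.1 ∧ Odd t.2.2) ∨
        (Odd t.1 ∧ Odd t.2.1 ∧ Even t.2.2)),
      tz t.1 t.2.1 t.2.2) = 3 / 8 * rz l + 1 / 4 * rz (l - 2) * rz 2 := by
  obtain ⟨M, rfl⟩ : ∃ M, l = 2 * (M + 2) := by
    obtain ⟨k, rfl⟩ := hev
    exact ⟨k - 2, by omega⟩
  have htot := sum_tz_TIdx (2 * M)
  rw [show 2 * M + 4 = 2 * (M + 2) by ring, ← Finset.sum_filter_add_sum_filter_not _ (fun t =>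
        (Even t.1 ∧ Odd t.2.1 ∧ Odd t.2.2) ∨ (Odd t.1 ∧ Even t.2.1 ∧ Odd t.2.2) ∨
        (Odd t.1 ∧ Odd t.2.1 ∧ Even t.2.2))] at htot
  suffices h : ∑ t ∈ (TIdx (2 * (M + 2))).filter (fun t =>
        ¬((Even t.1 ∧ Odd t.2.1 ∧ Odd t.2.2) ∨ (Odd t.1 ∧ Even t.2.1 ∧ Odd t.2.2) ∨
        (Odd t.1 ∧ Odd t.2.1 ∧ Even t.2.2))), tz t.1 t.2.1 t.2.2 =
      5 / 8 * rz (2 * (M + 2)) - 1 / 4 * (rz 2 * rz (2 * (M + 1))) by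
    rw [show 2 * (M + 2) - 2 = 2 * (M + 1) by omega]
    linear_combination htot - h
  rcases M with _ | N
  · have hE := sum_antidiagonal_rz_mul_rz 0
    simp only [Finset.HasAntidiagonal.antidiagonal_zero, Finset.sum_singleton] at hE
    rw [Finset.filter_eq_empty_iff.mpr, Finset.sum_empty]
    · norm_num at hE ⊢
      linear_combination 1 / 4 * hE
    · rintro ⟨a, b, c⟩ h
      simp only [TIdx, Finset.mem_filter, Finset.mem_product, Finset.mem_range, Nat.odd_iff,
        Nat.even_iff] at h ⊢
      omega
  · rw [← sum_tz_even N]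
    symm
    apply Finset.sum_nbij' (fun t => (2 * (t.1 + 1), 2 * (t.2.1 + 1), 2 * (t.2.2 + 1)))
      (fun t => (t.1 / 2 - 1, t.2.1 / 2 - 1, t.2.2 / 2 - 1)) <;>
      simp only [mem_triples, TIdx, Finset.mem_filter, Finset.mem_product, Finset.mem_range,
        implies_true, Nat.odd_iff, Nat.even_iff] <;>
      rintro ⟨a, b, c⟩ h <;> simp only [Prod.mk.injEq] at h ⊢ <;> omega
end
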